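/- If a nondeterministic parity GFG automaton N recognises a language L and a nondeterministic parity GFG automaton N' recognises the complement of L, then there exists a deterministic parity (Rabin) automaton for L with at most |N|·|N'| states. Consequently, in the construction of the family C_n, any GFG universal parity automaton E_n for L(C_n) must have 2^{Ω(n)} states. -/

import Mathlib

namespace GFGPaper

/-- Positive Boolean formulas over `Q`. -/
inductive PosBool (Q : Type) : Type
  | atom : Q → PosBool Q
  | band : PosBool Q → PosBool Q → PosBool Q
  | bor  : PosBool Q → PosBool Q → PosBool Q

/-- A (positional) choice of Eve inside a positive Boolean formula:
she resolves every disjunction (possibly differently in different conjuncts). -/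
inductive EveChoice {Q : Type} : PosBool Q → Type
  | atom (q : Q) : EveChoice (PosBool.atom q)
  | band {φ ψ : PosBool Q} : EveChoice φ → EveChoice ψ → EveChoice (PosBool.band φ ψ)
  | borl {φ ψ : PosBool Q} : EveChoice φ → EveChoice (PosBool.bor φ ψ)
  | borr {φ ψ : PosBool Q} : EveChoice ψ → EveChoice (PosBool.bor φ ψ)

/-- The atoms that Adam (resolving conjunctions) can reach against Eve's choice. -/
def EveChoice.outcome {Q : Type} : {φ : PosBool Q} → EveChoice φ → Set Q
  | _, .atom q => {q}
  | _, .band c d => c.outcome ∪ d.outcome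
  | _, .borl c => c.outcome
  | _, .borr c => c.outcome

/-- A choice of Adam inside a positive Boolean formula: he resolves every conjunction. -/
inductive AdamChoice {Q : Type} : PosBool Q → Type
  | atom (q : Q) : AdamChoice (PosBool.atom q)
  | bandl {φ ψ : PosBool Q} : AdamChoice φ → AdamChoice (PosBool.band φ ψ)
  | bandr {φ ψ : PosBool Q} : AdamChoice ψ → AdamChoice (PosBool.band φ ψ)
  | bor {φ ψ : PosBool Q} : AdamChoice φ → AdamChoice ψ → AdamChoice (PosBool.bor φ ψ)

/-- The atoms Eve (resolving disjunctions) can reach against Adam's choice. -/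
def AdamChoice.outcome {Q : Type} : {φ : PosBool Q} → AdamChoice φ → Set Q
  | _, .atom q => {q}
  | _, .bandl c => c.outcome
  | _, .bandr c => c.outcome
  | _, .bor c d => c.outcome ∪ d.outcome

/-- The unique atom reached when Eve plays `e` and Adam plays `a` on the same formula. -/
def resolve {Q : Type} : {φ : PosBool Q} → EveChoice φ → AdamChoice φ → Q
  | _, .atom q, _ => q
  | _, .band c _, .bandl e => resolve c e
  | _, .band _ d, .bandr e => resolve d e
  | _, .borl c, .bor e _ => resolve c e
  | _, .borr c, .bor _ f => resolve c f

def InfOften (p : ℕ → Prop) : Prop := ∀ N, ∃ n, N ≤ n ∧ p n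

/-- The parity condition: the maximal priority occurring infinitely often is even. -/
def ParityAcc (c : ℕ → ℕ) : Prop :=
  ∃ p, Even p ∧ InfOften (fun n => c n = p) ∧ ∀ q, p < q → ¬ InfOften (fun n => c n = q)

/-- An alternating automaton with an abstract acceptance condition on
infinite sequences of transitions. -/
structure AltAut (A Q : Type) where
  init : Q
  δ : Q → A → PosBool Q
  acc : (ℕ → Q × A × Q) → Prop

def trace {A Q : Type} (w : ℕ → A) (ρ : ℕ → Q) : ℕ → Q × A × Q :=
  fun n => (ρ n, w n, ρ (n + 1))

/-- Acceptance via the model-checking game: Eve has a (history-dependent)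
strategy resolving the disjunctions such that every consistent path
(i.e. every way for Adam to resolve the conjunctions) is accepting. -/
def AltAut.Accepts {A Q : Type} (M : AltAut A Q) (w : ℕ → A) : Prop :=
  ∃ σ : List Q → (n : ℕ) → (q : Q) → EveChoice (M.δ q (w n)),
    ∀ ρ : ℕ → Q, ρ 0 = M.init →
      (∀ n, ρ (n + 1) ∈ (σ (List.ofFn fun i : Fin n => ρ i.val) n (ρ n)).outcome) →
      M.acc (trace w ρ)

/-- Eve wins her letter game: she resolves disjunctions online (knowing only the
play so far) so that whenever the word Adam produces is in the language,
the constructed path is accepting. -/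
def ExistsGFG {A Q : Type} (M : AltAut A Q) : Prop :=
  ∃ σ : List (A × Q) → (a : A) → (q : Q) → EveChoice (M.δ q a),
    ∀ (w : ℕ → A) (ρ : ℕ → Q), ρ 0 = M.init →
      (∀ n, ρ (n + 1) ∈
        (σ (List.ofFn fun i : Fin n => (w i.val, ρ (i.val + 1))) (w n) (ρ n)).outcome) →
      M.Accepts w → M.acc (trace w ρ)

/-- Adam wins his letter game: he resolves conjunctions online so that whenever the
word is not in the language, the constructed path is rejecting. -/
def ForallGFG {A Q : Type} (M : AltAut A Q) : Prop :=
  ∃ τ : List (A × Q) → (a : A) → (q : Q) → AdamChoice (M.δ q a),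
    ∀ (w : ℕ → A) (ρ : ℕ → Q), ρ 0 = M.init →
      (∀ n, ρ (n + 1) ∈
        (τ (List.ofFn fun i : Fin n => (w i.val, ρ (i.val + 1))) (w n) (ρ n)).outcome) →
      M.Accepts w ∨ ¬ M.acc (trace w ρ)

/-- Eve wins her letter game with a strategy that is positional in the expanded
letter game, i.e. depends only on the word read so far and the current state. -/
def EveWinsPositional {A Q : Type} (M : AltAut A Q) : Prop :=
  ∃ σ : List A → (a : A) → (q : Q) → EveChoice (M.δ q a),
    ∀ (w : ℕ → A) (ρ : ℕ → Q), ρ 0 = M.init →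
      (∀ n, ρ (n + 1) ∈ (σ (List.ofFn fun i : Fin n => w i.val) (w n) (ρ n)).outcome) →
      M.Accepts w → M.acc (trace w ρ)

/-- Alternating parity automaton (priorities on transitions). -/
structure APW (A Q : Type) where
  init : Q
  δ : Q → A → PosBool Q
  prio : Q → A → Q → ℕ

def APW.toAlt {A Q : Type} (M : APW A Q) : AltAut A Q :=
  { init := M.init, δ := M.δ,
    acc := fun t => ParityAcc fun n => M.prio (t n).1 (t n).2.1 (t n).2.2 }

def APW.Accepts {A Q : Type} (M : APW A Q) (w : ℕ → A) : Prop := M.toAlt.Accepts w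

def PosBool.dual {Q : Type} : PosBool Q → PosBool Q
  | .atom q => .atom q
  | .band φ ψ => .bor φ.dual ψ.dual
  | .bor φ ψ => .band φ.dual ψ.dual

/-- The dual automaton: swap ∧/∨ and increase all priorities by one. -/
def APW.dual {A Q : Type} (M : APW A Q) : APW A Q :=
  { init := M.init, δ := fun q a => (M.δ q a).dual,
    prio := fun q a q' => M.prio q a q' + 1 }

/-- The box of a positional Eve strategy on the one-step arena over `a`. -/
def stratBox {A Q : Type} (δ : Q → A → PosBool Q) (a : A)
    (σ : (q : Q) → EveChoice (δ q a)) : Set (Q × A × Q) :=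
  { t | t.2.1 = a ∧ t.2.2 ∈ (σ t.1).outcome }

def BoxesAt {A Q : Type} (δ : Q → A → PosBool Q) (a : A) : Set (Set (Q × A × Q)) :=
  Set.range (stratBox δ a)

def Boxes {A Q : Type} (δ : Q → A → PosBool Q) : Set (Set (Q × A × Q)) :=
  ⋃ a, BoxesAt δ a

/-- A sequence of boxes is universally accepting if every path through it is accepting. -/
def UnivAcc {A Q : Type} (M : AltAut A Q) (β : ℕ → Set (Q × A × Q)) : Prop :=
  ∀ (ρ : ℕ → Q) (wa : ℕ → A), ρ 0 = M.init →
    (∀ n, (ρ n, wa n, ρ (n + 1)) ∈ β n) →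
    M.acc (fun n => (ρ n, wa n, ρ (n + 1)))

/-- Deterministic parity automaton (priorities on transitions). -/
structure DPA (A P : Type) where
  init : P
  step : P → A → P
  prio : P → A → ℕ

def DPA.run {A P : Type} (D : DPA A P) (w : ℕ → A) : ℕ → P
  | 0 => D.init
  | n + 1 => D.step (DPA.run D w n) (w n)

def DPA.Accepts {A P : Type} (D : DPA A P) (w : ℕ → A) : Prop :=
  ParityAcc fun n => D.prio (D.run w n) (w n)

def pref {A : Type} (w : ℕ → A) (n : ℕ) : List A := List.ofFn fun i : Fin n => w i.val

/-- Nondeterministic parity automaton. -/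
structure NPA (A P : Type) where
  init : P
  Δ : P → A → Set P
  prio : P → A → P → ℕ

def NPA.IsRun {A P : Type} (N : NPA A P) (w : ℕ → A) (ρ : ℕ → P) : Prop :=
  ρ 0 = N.init ∧ ∀ n, ρ (n + 1) ∈ N.Δ (ρ n) (w n)

def NPA.Accepts {A P : Type} (N : NPA A P) (w : ℕ → A) : Prop :=
  ∃ ρ, N.IsRun w ρ ∧ ParityAcc fun n => N.prio (ρ n) (w n) (ρ (n + 1))

/-- A nondeterministic automaton is GFG if its nondeterminism can be resolved
based only on the prefix of the word read so far. -/
def NPA.GFG {A P : Type} (N : NPA A P) : Prop :=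
  ∃ f : List A → P, f [] = N.init ∧ (∀ u a, f (u ++ [a]) ∈ N.Δ (f u) a) ∧
    ∀ w : ℕ → A, N.Accepts w →
      ParityAcc fun n => N.prio (f (pref w n)) (w n) (f (pref w (n + 1)))

/-- Universal parity automaton. -/
structure UPA (A P : Type) where
  init : P
  Δ : P → A → Set P
  prio : P → A → P → ℕ

def UPA.IsRun {A P : Type} (N : UPA A P) (w : ℕ → A) (ρ : ℕ → P) : Prop :=
  ρ 0 = N.init ∧ ∀ n, ρ (n + 1) ∈ N.Δ (ρ n) (w n)

def UPA.Accepts {A P : Type} (N : UPA A P) (w : ℕ → A) : Prop :=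
  ∀ ρ, N.IsRun w ρ → ParityAcc fun n => N.prio (ρ n) (w n) (ρ (n + 1))

/-- A universal automaton is GFG if its universality can be resolved online:
on every word outside the language the produced run is rejecting. -/
def UPA.GFG {A P : Type} (N : UPA A P) : Prop :=
  ∃ f : List A → P, f [] = N.init ∧ (∀ u a, f (u ++ [a]) ∈ N.Δ (f u) a) ∧
    ∀ w : ℕ → A, ¬ N.Accepts w →
      ¬ ParityAcc fun n => N.prio (f (pref w n)) (w n) (f (pref w (n + 1)))

/-- A run of the box automaton `A^□` over `w` is a sequence of boxes. -/
def BoxRun {A Q : Type} (M : APW A Q) (w : ℕ → A) (β : ℕ → Set (Q × A × Q)) : Prop :=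
  ∀ n, β n ∈ BoxesAt M.δ (w n)

/-- Acceptance of the box automaton `A^□` built on a deterministic automaton `B`
over boxes: some box run is accepted by `B`. -/
def boxAccepts {A Q P : Type} (M : APW A Q) (B : DPA (Set (Q × A × Q)) P)
    (w : ℕ → A) : Prop :=
  ∃ β, BoxRun M w β ∧ B.Accepts β

/-- GFGness of the box automaton `A^□`: the box (its only nondeterminism) can be
chosen based only on the prefix of the word read. -/
def boxGFG {A Q P : Type} (M : APW A Q) (B : DPA (Set (Q × A × Q)) P) : Prop :=
  ∃ g : List A → A → Set (Q × A × Q),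
    (∀ u a, g u a ∈ BoxesAt M.δ a) ∧
    ∀ w : ℕ → A, boxAccepts M B w → B.Accepts (fun n => g (pref w n) (w n))

/-- A Rabin/Streett pair of sets of transitions. -/
structure RabinPair (T : Type) where
  bad : Set T
  good : Set T

def RabinAcc {T : Type} (pairs : Set (RabinPair T)) (t : ℕ → T) : Prop :=
  ∃ p ∈ pairs, (¬ InfOften fun n => t n ∈ p.bad) ∧ InfOften fun n => t n ∈ p.good

def StreettAcc {T : Type} (pairs : Set (RabinPair T)) (t : ℕ → T) : Prop :=
  ∀ p ∈ pairs, (¬ InfOften fun n => t n ∈ p.bad) ∨ InfOften fun n => t n ∈ p.good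

/-- Alternating Rabin automaton. -/
structure ARW (A Q : Type) where
  init : Q
  δ : Q → A → PosBool Q
  pairs : Set (RabinPair (Q × A × Q))

def ARW.toAlt {A Q : Type} (M : ARW A Q) : AltAut A Q :=
  { init := M.init, δ := M.δ, acc := RabinAcc M.pairs }

/-- Alternating Streett automaton. -/
structure ASW (A Q : Type) where
  init : Q
  δ : Q → A → PosBool Q
  pairs : Set (RabinPair (Q × A × Q))

def ASW.toAlt {A Q : Type} (M : ASW A Q) : AltAut A Q :=
  { init := M.init, δ := M.δ, acc := StreettAcc M.pairs }

end GFGPaper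

namespace GFGPaper

/-! ### Infinitely often and parity acceptance -/

theorem infOften_mono {p q : ℕ → Prop} (hp : InfOften p) (h : ∀ n, p n → q n) : InfOften q :=
  fun N => let ⟨n, hn, hpn⟩ := hp N; ⟨n, hn, h n hpn⟩

theorem infOften_of_eventually {p q : ℕ → Prop} (hp : InfOften p) {N : ℕ}
    (h : ∀ n, N ≤ n → p n → q n) : InfOften q := fun M =>
  let ⟨n, hn, hpn⟩ := hp (max M N)
  ⟨n, (le_max_left _ _).trans hn, h n ((le_max_right _ _).trans hn) hpn⟩

theorem not_infOften {p : ℕ → Prop} : ¬ InfOften p ↔ ∃ N, ∀ n, N ≤ n → ¬ p n := by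
  simp [InfOften]

theorem infOften_pigeonhole {α : Type*} [Finite α] (g : ℕ → α) {p : ℕ → Prop} (hp : InfOften p) :
    ∃ x, InfOften fun n => p n ∧ g n = x := by
  by_contra hcon
  simp only [not_exists, not_infOften] at hcon
  choose N hN using hcon
  obtain ⟨B, hB⟩ := (Set.finite_range N).bddAbove
  obtain ⟨n, hn, hpn⟩ := hp B
  exact hN (g n) n ((hB ⟨_, rfl⟩).trans hn) ⟨hpn, rfl⟩

theorem infOften_shift {p : ℕ → Prop} (k : ℕ) : InfOften (fun n => p (n + k)) ↔ InfOften p := by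
  constructor
  · intro h N
    obtain ⟨n, hn, h⟩ := h N
    exact ⟨n + k, by omega, h⟩
  · intro h N
    obtain ⟨n, hn, h⟩ := h (N + k)
    exact ⟨n - k, by omega, by dsimp only; rwa [Nat.sub_add_cancel (by omega)]⟩

theorem parityAcc_shift {c : ℕ → ℕ} (k : ℕ) : ParityAcc (fun n => c (n + k)) ↔ ParityAcc c := by
  unfold ParityAcc
  refine exists_congr fun p => and_congr_right fun _ => and_congr (infOften_shift (p := (c · = p)) k)
    (forall₂_congr fun q _ => not_congr (infOften_shift (p := (c · = q)) k))

theorem parityAcc_of_eventually_eq {c d : ℕ → ℕ} (h : ParityAcc c) {N : ℕ}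
    (hcd : ∀ n, N ≤ n → c n = d n) : ParityAcc d := by
  obtain ⟨p, hp, hi, hq⟩ := h
  refine ⟨p, hp, infOften_of_eventually hi fun n hn h => (hcd n hn) ▸ h, fun q hpq hd => ?_⟩
  exact hq q hpq (infOften_of_eventually hd fun n hn h => (hcd n hn).symm ▸ h)

/-- Above an upper bound, finitely often for each colour becomes eventually not above. -/
theorem eventually_le_of_bounded {c : ℕ → ℕ} {B p : ℕ} (hB : ∀ n, c n ≤ B)
    (h : ∀ q, p < q → ¬ InfOften fun n => c n = q) : ∃ N, ∀ n, N ≤ n → c n ≤ p := by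
  by_contra! hcon
  obtain ⟨x, hx⟩ := infOften_pigeonhole (fun n => (⟨c n, Nat.lt_succ_of_le (hB n)⟩ : Fin (B + 1)))
    (p := fun n => p < c n) hcon
  obtain ⟨n, -, hn, rfl⟩ := hx 0
  exact h (c n) hn (infOften_mono hx fun m hm => by simpa using hm.2)

theorem exists_limsup_of_bounded {c : ℕ → ℕ} {B : ℕ} (hB : ∀ n, c n ≤ B) :
    ∃ p, InfOften (fun n => c n = p) ∧ ∀ q, p < q → ¬ InfOften fun n => c n = q := by
  classical
  obtain ⟨x, hx⟩ := infOften_pigeonhole (fun n => (⟨c n, Nat.lt_succ_of_le (hB n)⟩ : Fin (B + 1)))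
    (p := fun _ => True) (fun N => ⟨N, le_rfl, trivial⟩)
  have hne : ∃ p, p ≤ B ∧ InfOften fun n => c n = p :=
    ⟨x, by omega, infOften_mono hx fun m hm => by simpa using congrArg Fin.val hm.2⟩
  have hle : ∀ p, (InfOften fun n => c n = p) → p ≤ B := fun p hp => by
    obtain ⟨n, -, rfl⟩ := hp 0
    exact hB n
  obtain ⟨p, hpB, hp⟩ := hne
  refine ⟨Nat.findGreatest (fun p => InfOften fun n => c n = p) B,
    Nat.findGreatest_spec (P := fun p => InfOften fun n => c n = p) hpB hp, fun q hq hi => ?_⟩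
  exact Nat.findGreatest_is_greatest hq (hle q hi) hi

theorem parityAcc_succ_of_bounded {c : ℕ → ℕ} {B : ℕ} (hB : ∀ n, c n ≤ B) :
    (ParityAcc fun n => c n + 1) ↔ ¬ ParityAcc c := by
  obtain ⟨p, hp, hq⟩ := exists_limsup_of_bounded hB
  constructor
  · rintro ⟨q, hqe, hqi, hqm⟩ ⟨r, hre, hri, hrm⟩
    obtain ⟨n, -, hn⟩ := hqi 0
    have h1 : InfOften fun n => c n = q - 1 := infOften_mono hqi fun n hn => by dsimp only at hn ⊢; omega
    have h2 : ¬ r < q - 1 := fun h => hrm _ h h1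
    have h3 : ¬ q < r + 1 := fun h => hqm _ h (infOften_mono hri fun n hn => by dsimp only at hn ⊢; omega)
    have : q = r + 1 := by omega
    subst this
    exact (Nat.not_even_iff_odd.2 hre.add_one) hqe
  · intro h
    refine ⟨p + 1, ?_, infOften_mono hp fun n hn => by dsimp only at hn ⊢; omega, fun q hlt hi => ?_⟩
    · by_contra hodd
      exact h ⟨p, by simpa [Nat.even_add_one] using hodd, hp, hq⟩
    · exact hq (q - 1) (by omega) (infOften_mono hi fun n hn => by dsimp only at hn ⊢; omega)

/-- If colours are eventually at most `p` and `p` recurs, acceptance is the parity of `p`. -/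
theorem parityAcc_iff_even {c : ℕ → ℕ} {p N : ℕ} (hp : InfOften fun n => c n = p)
    (hN : ∀ n, N ≤ n → c n ≤ p) : ParityAcc c ↔ Even p := by
  have hm : ∀ q, p < q → ¬ InfOften fun n => c n = q := fun q hq hi => by
    obtain ⟨n, hn, rfl⟩ := hi N
    exact absurd (hN n hn) (by omega)
  refine ⟨?_, fun h => ⟨p, h, hp, hm⟩⟩
  rintro ⟨q, hqe, hqi, hqm⟩
  rcases lt_trichotomy p q with h | rfl | h
  · exact absurd hqi (hm q h)
  · exact hqe
  · exact absurd hp (hqm p h)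

/-! ### Capping colours -/

/-- Colours above `k` are replaced by an odd colour dominating all others. -/
def cap (k x : ℕ) : ℕ := if x ≤ k then x else 2 * k + 1

theorem cap_le (k x : ℕ) : cap k x ≤ 2 * k + 1 := by unfold cap; split_ifs <;> omega

theorem parityAcc_cap {k : ℕ} {c : ℕ → ℕ} : (ParityAcc fun n => cap k (c n)) ↔
    ∃ p, Even p ∧ p ≤ k ∧ InfOften (fun n => c n = p) ∧ ∃ N, ∀ n, N ≤ n → c n ≤ p := by
  constructor
  · rintro ⟨p, hpe, hpi, hpm⟩
    obtain ⟨N, hN⟩ := eventually_le_of_bounded (fun n => cap_le k (c n)) hpm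
    have hk : p ≤ k := by
      obtain ⟨n, -, rfl⟩ := hpi 0
      dsimp only [cap] at hpe ⊢
      split_ifs at hpe ⊢ with h
      · exact h
      · exact absurd hpe (by simp)
    refine ⟨p, hpe, hk, infOften_mono hpi fun n hn => ?_, N, fun n hn => ?_⟩
    · dsimp only [cap] at hn; split_ifs at hn <;> omega
    · have := hN n hn
      unfold cap at this; split_ifs at this <;> omega
  · rintro ⟨p, hpe, hk, hpi, N, hN⟩
    refine (parityAcc_iff_even (p := p) (N := N) (infOften_mono hpi fun n hn => ?_)
      fun n hn => ?_).2 hpe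
    · dsimp only [cap] at hn ⊢; rw [if_pos (by omega), hn]
    · have := hN n hn
      unfold cap; rw [if_pos (by omega)]; exact this

theorem parityAcc_cap_mono {k k' : ℕ} (h : k ≤ k') {c : ℕ → ℕ}
    (hc : ParityAcc fun n => cap k (c n)) : ParityAcc fun n => cap k' (c n) := by
  obtain ⟨p, h1, h2, h3⟩ := parityAcc_cap.1 hc
  exact parityAcc_cap.2 ⟨p, h1, h2.trans h, h3⟩

theorem parityAcc_of_cap {k : ℕ} {c : ℕ → ℕ} (hc : ParityAcc fun n => cap k (c n)) :
    ParityAcc c := by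
  obtain ⟨p, h1, h2, h3, N, h4⟩ := parityAcc_cap.1 hc
  exact (parityAcc_iff_even h3 h4).2 h1

/-! ### Walks in labelled graphs and their concatenation -/

inductive Walk {V A : Type} (E : V → A → V → Prop) : V → List (V × A × V) → V → Prop
  | nil (v : V) : Walk E v [] v
  | cons {u : V} {a : A} {v v' : V} {l : List (V × A × V)} :
      E u a v → Walk E v l v' → Walk E u ((u, a, v) :: l) v'

namespace Walk

variable {V V' A : Type} {E E' : V → A → V → Prop}

theorem single {u : V} {a : A} {v : V} (h : E u a v) : Walk E u [(u, a, v)] v :=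
  .cons h (.nil v)

theorem append {u v v' : V} {l l' : List (V × A × V)} (h : Walk E u l v) (h' : Walk E v l' v') :
    Walk E u (l ++ l') v' := by
  induction h with
  | nil => exact h'
  | cons he _ ih => exact .cons he (ih h')

theorem edge {u v : V} {l : List (V × A × V)} (h : Walk E u l v) :
    ∀ x ∈ l, E x.1 x.2.1 x.2.2 := by
  induction h with
  | nil => simp
  | cons he _ ih => simpa using ⟨he, fun a b c => ih (a, b, c)⟩

theorem mono {u v : V} {l : List (V × A × V)} (h : Walk E u l v)
    (hE : ∀ x ∈ l, E x.1 x.2.1 x.2.2 → E' x.1 x.2.1 x.2.2) : Walk E' u l v := by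
  induction h with
  | nil => exact .nil _
  | cons he _ ih => exact .cons (hE _ List.mem_cons_self he) (ih fun x hx => hE x (by simp [hx]))

theorem map {E' : V' → A → V' → Prop} (f : V → V')
    (hE : ∀ u a v, E u a v → E' (f u) a (f v)) {u v : V} {l : List (V × A × V)}
    (h : Walk E u l v) : Walk E' (f u) (l.map fun x => (f x.1, x.2.1, f x.2.2)) (f v) := by
  induction h with
  | nil => exact .nil _
  | cons he _ ih => exact .cons (hE _ _ _ he) ih

theorem split {u v : V} {l : List (V × A × V)} (h : Walk E u l v) {x : V × A × V} (hx : x ∈ l) :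
    ∃ l₁ l₂, l = l₁ ++ x :: l₂ ∧ Walk E u l₁ x.1 ∧ Walk E x.2.2 l₂ v := by
  induction h with
  | nil => simp at hx
  | cons he hw ih =>
    rcases List.mem_cons.1 hx with rfl | hx
    · exact ⟨[], _, rfl, .nil _, hw⟩
    · obtain ⟨l₁, l₂, rfl, h₁, h₂⟩ := ih hx
      exact ⟨_ :: l₁, l₂, rfl, .cons he h₁, h₂⟩

theorem of_play {ρ : ℕ → V} {w : ℕ → A} (h : ∀ n, E (ρ n) (w n) (ρ (n + 1))) (n m : ℕ) :
    ∃ l, Walk E (ρ n) l (ρ (n + m)) ∧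
      ∀ x, x ∈ l ↔ ∃ i, n ≤ i ∧ i < n + m ∧ x = (ρ i, w i, ρ (i + 1)) := by
  induction m with
  | zero => exact ⟨[], .nil _, fun x => by simp; intros; omega⟩
  | succ m ih =>
    obtain ⟨l, hl, hx⟩ := ih
    refine ⟨l ++ [_], hl.append (.single (h (n + m))), fun x => ?_⟩
    rw [List.mem_append, hx, List.mem_singleton]
    constructor
    · rintro (⟨i, h1, h2, rfl⟩ | rfl)
      exacts [⟨i, h1, by omega, rfl⟩, ⟨n + m, by omega, by omega, rfl⟩]
    · rintro ⟨i, h1, h2, rfl⟩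
      rcases Nat.lt_succ_iff_lt_or_eq.1 (show i < (n + m) + 1 by omega) with h | rfl
      exacts [.inl ⟨i, h1, h, rfl⟩, .inr rfl]

/-- The source of the `k`-th edge, or the end point once the walk is over. -/
theorem link {u v : V} {l : List (V × A × V)} (h : Walk E u l v) :
    (∀ hl : 0 < l.length, l[0].1 = u) ∧
    (∀ k (hk : k + 1 < l.length), l[k].2.2 = l[k + 1].1) ∧
    (∀ k (hk : k < l.length), k + 1 = l.length → l[k].2.2 = v) := by
  induction h with
  | nil => simp
  | @cons u a v v' l he hw ih =>
    obtain ⟨h1, h2, h3⟩ := ih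
    refine ⟨by simp, fun k hk => ?_, fun k hk hlast => ?_⟩
    · cases k with
      | zero => exact (h1 (by simpa using hk)).symm
      | succ k => exact h2 k (by simpa using hk)
    · cases k with
      | zero =>
        have : l = [] := by simpa using hlast
        subst this
        cases hw
        rfl
      | succ k => exact h3 k (by simpa using hk) (by simpa using hlast)

/-- Concatenating infinitely many nonempty walks gives an infinite play. -/
theorem concat {v : ℕ → V} {l : ℕ → List (V × A × V)}
    (h : ∀ j, Walk E (v j) (l j) (v (j + 1))) (hne : ∀ j, l j ≠ []) :
    ∃ (ρ : ℕ → V) (w : ℕ → A), ρ 0 = v 0 ∧ (∀ n, E (ρ n) (w n) (ρ (n + 1))) ∧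
      (∀ J, ∃ N, ∀ n, N ≤ n → ∃ j, J ≤ j ∧ (ρ n, w n, ρ (n + 1)) ∈ l j) ∧
      (∀ j, ∀ x ∈ l j, ∃ n, j ≤ n ∧ (ρ n, w n, ρ (n + 1)) = x) := by
  let nxt : ℕ × ℕ → ℕ × ℕ := fun q => if q.2 + 1 < (l q.1).length then (q.1, q.2 + 1) else (q.1 + 1, 0)
  let pos : ℕ → ℕ × ℕ := fun n => nxt^[n] (0, 0)
  have hpos_succ : ∀ n, pos (n + 1) = nxt (pos n) := fun n => Function.iterate_succ_apply' _ _ _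
  have hlen : ∀ j, 0 < (l j).length := fun j => List.length_pos_iff.2 (hne j)
  have hvalid : ∀ n, (pos n).2 < (l (pos n).1).length := by
    intro n
    induction n with
    | zero => exact hlen 0
    | succ n ih =>
      rw [hpos_succ]
      simp only [nxt]
      split_ifs with h
      exacts [h, hlen _]
  let e : ℕ → V × A × V := fun n => (l (pos n).1)[(pos n).2]'(hvalid n)
  have hE : ∀ n m j k (hk : k < (l j).length), pos n = (j, k) → m = n → e m = (l j)[k] := by
    rintro n m j k hk hn rfl
    simp only [e]
    congr 1 <;> simp [hn]
  have hlink : ∀ n, (e n).2.2 = (e (n + 1)).1 := by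
    intro n
    obtain ⟨h1, h2, h3⟩ := (h (pos n).1).link
    by_cases hk : (pos n).2 + 1 < (l (pos n).1).length
    · have hp : pos (n + 1) = ((pos n).1, (pos n).2 + 1) := by
        rw [hpos_succ]; simp only [nxt]; rw [if_pos hk]
      rw [hE _ _ _ _ hk hp rfl]
      exact h2 _ hk
    · have hp : pos (n + 1) = ((pos n).1 + 1, 0) := by
        rw [hpos_succ]; simp only [nxt]; rw [if_neg hk]
      rw [hE _ _ _ _ (hlen _) hp rfl, ((h ((pos n).1 + 1)).link).1 (hlen _)]
      exact h3 _ (hvalid n) (by have := hvalid n; omega)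
  have heq : ∀ n, ((e n).1, (e n).2.1, (e (n + 1)).1) = e n := fun n => by rw [← hlink]
  have hmono1 : ∀ n, (pos n).1 ≤ (pos (n + 1)).1 := fun n => by
    rw [hpos_succ]; simp only [nxt]; split_ifs <;> simp
  have hmono : Monotone fun n => (pos n).1 := monotone_nat_of_le_succ hmono1
  have hstep : ∀ j k n, pos n = (j, 0) → k < (l j).length → ∃ m, n ≤ m ∧ pos m = (j, k) := by
    intro j k n hn hk
    refine ⟨n + k, by omega, ?_⟩
    induction k with
    | zero => exact hn
    | succ k ih =>
      rw [← add_assoc, hpos_succ, ih (by omega)]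
      simp only [nxt]
      rw [if_pos hk]
  have hstart : ∀ j, ∃ n, j ≤ n ∧ pos n = (j, 0) := by
    intro j
    induction j with
    | zero => exact ⟨0, le_rfl, rfl⟩
    | succ j ih =>
      obtain ⟨n, hn, hp⟩ := ih
      obtain ⟨m, hm, hpm⟩ := hstep j ((l j).length - 1) n hp (by have := hlen j; omega)
      refine ⟨m + 1, by omega, ?_⟩
      rw [hpos_succ, hpm]
      simp only [nxt]
      rw [if_neg (by have := hlen j; omega)]
  refine ⟨fun n => (e n).1, fun n => (e n).2.1, ?_, fun n => ?_, fun J => ?_, fun j x hx => ?_⟩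
  · exact ((h 0).link).1 (hlen 0)
  · have := (h (pos n).1).edge (e n) (List.getElem_mem _)
    rwa [hlink] at this
  · obtain ⟨N, -, hN⟩ := hstart J
    refine ⟨N, fun n hn => ⟨(pos n).1, ?_, ?_⟩⟩
    · have := hmono hn
      simpa [hN] using this
    · rw [heq]; exact List.getElem_mem _
  · obtain ⟨k, hk, rfl⟩ := List.getElem_of_mem hx
    obtain ⟨n, hn, hpn⟩ := hstart j
    obtain ⟨m, hm, hpm⟩ := hstep j k n hpn hk
    exact ⟨m, by omega, by rw [heq]; exact hE _ _ _ _ hk hpm rfl⟩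

end Walk

/-! ### Reachability, extinct and persistent events -/

section Events

variable {H A : Type} {E : H → A → H → Prop}

def Reach (E : H → A → H → Prop) (h t : H) : Prop := ∃ l, Walk E h l t

/-- No edge reachable from `h` belongs to the event `D`. -/
def Extinct (E D : H → A → H → Prop) (h : H) : Prop :=
  ∀ h', Reach E h h' → ∀ a t, E h' a t → ¬ D h' a t

/-- From every vertex reachable from `h` an edge of the event `D` is reachable. -/
def Persistent (E D : H → A → H → Prop) (h : H) : Prop := ∀ h', Reach E h h' → ¬ Extinct E D h'

theorem Reach.refl (h : H) : Reach E h h := ⟨[], .nil h⟩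

theorem Reach.trans {h h' h'' : H} : Reach E h h' → Reach E h' h'' → Reach E h h''
  | ⟨_, hl⟩, ⟨_, hl'⟩ => ⟨_, hl.append hl'⟩

theorem Reach.step {h h' : H} {a : A} (he : E h a h') : Reach E h h' := ⟨_, .single he⟩

theorem Reach.of_play {ρ : ℕ → H} {w : ℕ → A} (hE : ∀ n, E (ρ n) (w n) (ρ (n + 1))) {n m : ℕ}
    (hnm : n ≤ m) : Reach E (ρ n) (ρ m) := by
  obtain ⟨l, hl, -⟩ := Walk.of_play hE n (m - n)
  exact ⟨l, by rwa [Nat.add_sub_cancel' hnm] at hl⟩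

theorem Reach.induct {K : Set H} (hK : ∀ h ∈ K, ∀ a h', E h a h' → h' ∈ K) {h h' : H}
    (hr : Reach E h h') (hh : h ∈ K) : h' ∈ K := by
  obtain ⟨l, hl⟩ := hr
  induction hl with
  | nil => exact hh
  | cons he _ ih => exact ih (hK _ hh _ _ he)

theorem Extinct.reach {D : H → A → H → Prop} {h h' : H} (hD : Extinct E D h) (hr : Reach E h h') :
    Extinct E D h' := fun _ hr' => hD _ (hr.trans hr')

theorem Persistent.reach {D : H → A → H → Prop} {h h' : H} (hD : Persistent E D h)
    (hr : Reach E h h') : Persistent E D h' := fun _ hr' => hD _ (hr.trans hr')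

theorem Persistent.exists_walk {D : H → A → H → Prop} {h : H} (hD : Persistent E D h) :
    ∃ l h', Walk E h l h' ∧ ∃ x ∈ l, D x.1 x.2.1 x.2.2 := by
  have := hD h (Reach.refl h)
  simp only [Extinct] at this
  push Not at this
  obtain ⟨h', ⟨l, hl⟩, a, h'', he, hd⟩ := this
  exact ⟨l ++ [(h', a, h'')], h'', hl.append (.single he), (h', a, h''), by simp, hd⟩

theorem not_persistent {D : H → A → H → Prop} {h : H} (hD : ¬ Persistent E D h) :
    ∃ h', Reach E h h' ∧ Extinct E D h' := by
  simpa [Persistent] using hD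

/-- A generic play: it visits countably many prescribed dense sets, and sees infinitely often
every event which is persistent somewhere along it. -/
theorem exists_generic_play {h₀ : H} (live : ∀ h, Reach E h₀ h → ∃ a h', E h a h')
    (D : ℕ → H → A → H → Prop) (T : ℕ → H → Prop)
    (dense : ∀ j h, Reach E h₀ h → ∃ h', Reach E h h' ∧ T j h') :
    ∃ (ρ : ℕ → H) (w : ℕ → A), ρ 0 = h₀ ∧ (∀ n, E (ρ n) (w n) (ρ (n + 1))) ∧
      (∀ j, ∃ n, T j (ρ n)) ∧
      ∀ i n, Persistent E (D i) (ρ n) → InfOften fun n => D i (ρ n) (w n) (ρ (n + 1)) := by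
  have step : ∀ j (h : {h // Reach E h₀ h}), ∃ (h' : {h // Reach E h₀ h}) (l : _),
      Walk E h.1 l h'.1 ∧ l ≠ [] ∧ T j h'.1 ∧
        (Persistent E (D j.unpair.1) h.1 → ∃ x ∈ l, D j.unpair.1 x.1 x.2.1 x.2.2) := by
    rintro j ⟨h, hr⟩
    obtain ⟨l₁, h₁, hl₁, hp⟩ : ∃ l h', Walk E h l h' ∧
        (Persistent E (D j.unpair.1) h → ∃ x ∈ l, D j.unpair.1 x.1 x.2.1 x.2.2) := by
      by_cases hp : Persistent E (D j.unpair.1) h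
      · obtain ⟨l, h', hl, hx⟩ := hp.exists_walk
        exact ⟨l, h', hl, fun _ => hx⟩
      · exact ⟨[], h, .nil h, fun hp' => absurd hp' hp⟩
    have hr₁ : Reach E h₀ h₁ := hr.trans ⟨_, hl₁⟩
    obtain ⟨a, h₂, he⟩ := live h₁ hr₁
    have hr₂ := hr₁.trans (Reach.step he)
    obtain ⟨h₃, ⟨l₃, hl₃⟩, hT⟩ := dense j h₂ hr₂
    refine ⟨⟨h₃, hr₂.trans ⟨_, hl₃⟩⟩, l₁ ++ (h₁, a, h₂) :: l₃, hl₁.append (.cons he hl₃), by simp,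
      hT, fun hp' => ?_⟩
    obtain ⟨x, hx, hd⟩ := hp hp'
    exact ⟨x, by simp [hx], hd⟩
  choose nx l hl hne hT hD using step
  let v : ℕ → {h // Reach E h₀ h} := fun n => Nat.rec ⟨h₀, Reach.refl h₀⟩ (fun j h => nx j h) n
  obtain ⟨ρ, w, h0, hE, -, hhit⟩ := Walk.concat (E := E) (v := fun j => (v j).1)
    (l := fun j => l j (v j)) (fun j => hl j (v j)) (fun j => hne j (v j))
  have hv : ∀ j, ∃ n, j ≤ n ∧ ρ n = (v j).1 := by
    intro j
    have hpos := List.length_pos_iff.2 (hne j (v j))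
    obtain ⟨n, hn, hx⟩ := hhit j _ (List.getElem_mem hpos)
    exact ⟨n, hn, by rw [← (hl j (v j)).link.1 hpos, ← hx]⟩
  refine ⟨ρ, w, h0, hE, fun j => ?_, fun i n hp N => ?_⟩
  · obtain ⟨n, -, hn⟩ := hv (j + 1)
    exact ⟨n, by rw [hn]; exact hT j (v j)⟩
  · have hj : max n N ≤ Nat.pair i (max n N) := Nat.right_le_pair _ _
    obtain ⟨m, hm, hρ⟩ := hv (Nat.pair i (max n N))
    have hp' := hp.reach (Reach.of_play hE (m := m) (by omega))
    rw [hρ] at hp'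
    have := hD (Nat.pair i (max n N)) (v (Nat.pair i (max n N)))
    rw [Nat.unpair_pair] at this
    obtain ⟨x, hx, hd⟩ := this hp'
    obtain ⟨k, hk, rfl⟩ := hhit _ x hx
    exact ⟨k, by omega, hd⟩

end Events

/-! ### Strategies for a disjunction of two parity conditions -/

section Strategies

variable {V A H : Type}

/-- One of the two colourings makes the play accepting. -/
def Good (c : Bool → V → A → V → ℕ) (ρ : ℕ → V) (w : ℕ → A) : Prop :=
  ∃ i, ParityAcc fun n => c i (ρ n) (w n) (ρ (n + 1))

theorem Good.of_shift {c : Bool → V → A → V → ℕ} {ρ : ℕ → V} {w : ℕ → A} (k : ℕ)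
    (h : Good c (fun n => ρ (n + k)) fun n => w (n + k)) : Good c ρ w := by
  obtain ⟨i, hi⟩ := h
  refine ⟨i, (parityAcc_shift k).1 ?_⟩
  simpa only [add_right_comm] using hi

/-- A strategy `nx` with memory `H`, projected by `st` to the graph `G`: it answers every letter
allowed by `ok`, follows edges of `G`, stays in `K`, and all its plays are good. -/
structure Wins (ok : V → A → Prop) (G : V → A → V → Prop) (c : Bool → V → A → V → ℕ)
    (K : Set H) (st : H → V) (nx : H → A → H) : Prop where
  closed : ∀ h ∈ K, ∀ a, ok (st h) a → nx h a ∈ K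
  edge : ∀ h ∈ K, ∀ a, ok (st h) a → G (st h) a (st (nx h a))
  good : ∀ (ρ : ℕ → H) (w : ℕ → A), ρ 0 ∈ K → (∀ n, ok (st (ρ n)) (w n)) →
    (∀ n, ρ (n + 1) = nx (ρ n) (w n)) → Good c (fun n => st (ρ n)) w

/-- The edges along which a strategy can be driven by allowed letters. -/
def Arena (ok : V → A → Prop) (st : H → V) (nx : H → A → H) : H → A → H → Prop :=
  fun h a h' => ok (st h) a ∧ h' = nx h a

variable {ok ok' : V → A → Prop} {G : V → A → V → Prop} {c : Bool → V → A → V → ℕ}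
  {K : Set H} {st : H → V} {nx : H → A → H}

theorem Wins.anti (hW : Wins ok G c K st nx) (h : ∀ r a, ok' r a → ok r a) :
    Wins ok' G c K st nx :=
  ⟨fun k hk a ha => hW.closed k hk a (h _ _ ha), fun k hk a ha => hW.edge k hk a (h _ _ ha),
    fun ρ w h0 ho hn => hW.good ρ w h0 (fun n => h _ _ (ho n)) hn⟩

theorem Wins.subset (hW : Wins ok G c K st nx) {K' : Set H} (hK : K' ⊆ K)
    (hc : ∀ h ∈ K', ∀ a, ok (st h) a → nx h a ∈ K') : Wins ok G c K' st nx :=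
  ⟨hc, fun k hk => hW.edge k (hK hk), fun ρ w h0 => hW.good ρ w (hK h0)⟩

theorem Wins.reach_mem (hW : Wins ok G c K st nx) {h h' : H} (hr : Reach (Arena ok st nx) h h')
    (hh : h ∈ K) : h' ∈ K :=
  hr.induct (fun _ hk a _ he => he.2 ▸ hW.closed _ hk a he.1) hh

theorem Wins.arena_edge (hW : Wins ok G c K st nx) {h h' : H} {a : A} (hh : h ∈ K)
    (he : Arena ok st nx h a h') : G (st h) a (st h') := he.2 ▸ hW.edge h hh a he.1

/-- Letters from which one cannot move into `X`. -/
def Avoids (ok : V → A → Prop) (G : V → A → V → Prop) (X : Set V) (r : V) (a : A) : Prop :=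
  ok r a ∧ ∀ r' ∈ X, ¬ G r a r'

open Classical in
theorem Wins.union {X S : Set V} {f g : V → A → V} (hX : Wins ok G c X id f)
    (hS : Wins (Avoids ok G X) G c S id g) : ∃ f', Wins ok G c (X ∪ S) id f' := by
  let f' : V → A → V := fun r a =>
    if r ∈ X then f r a else if h : ∃ r' ∈ X, G r a r' then h.choose else g r a
  have h1 : ∀ r a, r ∈ X → f' r a = f r a := fun r a hr => if_pos hr
  have h2 : ∀ r a, r ∉ X → (∃ r' ∈ X, G r a r') → f' r a ∈ X ∧ G r a (f' r a) := by
    intro r a hr h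
    simp only [f', if_neg hr, dif_pos h]
    exact h.choose_spec
  have h3 : ∀ r a, r ∉ X → ¬ (∃ r' ∈ X, G r a r') → f' r a = g r a := by
    intro r a hr h
    simp only [f', if_neg hr, dif_neg h]
  have hav : ∀ r a, ok r a → ¬ (∃ r' ∈ X, G r a r') → Avoids ok G X r a := fun r a ho h =>
    ⟨ho, fun r' hr' hg => h ⟨r', hr', hg⟩⟩
  refine ⟨f', fun r hr a ho => ?_, fun r hr a ho => ?_, fun ρ w h0 ho hn => ?_⟩
  · by_cases hX' : r ∈ X
    · rw [h1 r a hX']; exact .inl (hX.closed r hX' a ho)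
    by_cases h : ∃ r' ∈ X, G r a r'
    · exact .inl (h2 r a hX' h).1
    · rw [h3 r a hX' h]
      exact .inr (hS.closed r (hr.resolve_left hX') a (hav r a ho h))
  · simp only [id] at ho ⊢
    by_cases hX' : r ∈ X
    · rw [h1 r a hX']; exact hX.edge r hX' a ho
    by_cases h : ∃ r' ∈ X, G r a r'
    · exact (h2 r a hX' h).2
    · rw [h3 r a hX' h]
      exact hS.edge r (hr.resolve_left hX') a (hav r a ho h)
  · simp only [id] at ho ⊢
    by_cases hex : ∃ n, ρ n ∈ X
    · obtain ⟨n, hXn⟩ := hex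
      have hmem : ∀ k, ρ (k + n) ∈ X := by
        intro k
        induction k with
        | zero => simpa using hXn
        | succ k ih =>
          rw [add_right_comm, hn, h1 _ _ ih]
          exact hX.closed _ ih _ (ho _)
      refine Good.of_shift n (hX.good (fun k => ρ (k + n)) _ (hmem 0) (fun k => ho _) fun k => ?_)
      rw [add_right_comm, hn, h1 _ _ (hmem k)]
    · push Not at hex
      have hno : ∀ n, ¬ ∃ r' ∈ X, G (ρ n) (w n) r' := fun n h =>
        hex (n + 1) (hn n ▸ (h2 _ _ (hex n) h).1)
      exact hS.good ρ w (h0.resolve_left (hex 0)) (fun n => hav _ _ (ho n) (hno n))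
        fun n => by rw [hn, h3 _ _ (hex n) (hno n)]

/-- There is a largest positionally winning set, even up to moving into it. -/
theorem exists_maximal_positional [Finite V] (ok : V → A → Prop) (G : V → A → V → Prop)
    (c : Bool → V → A → V → ℕ) : ∃ X f, Wins ok G c X id f ∧
      ∀ S g, Wins (Avoids ok G X) G c S id g → S ⊆ X := by
  have hne : {X : Set V | ∃ f, Wins ok G c X id f}.Nonempty :=
    ⟨∅, fun r _ => r, by simp, by simp, by simp⟩
  obtain ⟨X, ⟨f, hf⟩, hmax⟩ := (Set.toFinite {X : Set V | ∃ f, Wins ok G c X id f}).exists_maximal hne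
  refine ⟨X, f, hf, fun S g hg => ?_⟩
  exact Set.subset_union_right.trans (hmax (hf.union hg) Set.subset_union_left)

/-- Removing a positionally winning set from a winning strategy. -/
theorem Wins.diff (hW : Wins ok G c K st nx) (X : Set V) :
    Wins (Avoids ok G X) G c {h | h ∈ K ∧ st h ∉ X} st nx :=
  (hW.anti fun _ _ h => h.1).subset (fun _ h => h.1) fun h hh a ha =>
    ⟨hW.closed h hh.1 a ha.1, fun hX => ha.2 _ hX (hW.edge h hh.1 a ha.1)⟩

/-- Edges of colour `q`. -/
def ColEq (c : Bool → V → A → V → ℕ) (st : H → V) (i : Bool) (q : ℕ) : H → A → H → Prop :=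
  fun h a h' => c i (st h) a (st h') = q

/-- Somewhere in the arena of a winning strategy, an even colour is persistent while all larger
colours can be made extinct. -/
theorem Wins.exists_persistent (hW : Wins ok G c K st nx) {h₀ : H} (h0 : h₀ ∈ K)
    (live : ∀ h ∈ K, ∃ a, ok (st h) a) :
    ∃ h₁, Reach (Arena ok st nx) h₀ h₁ ∧ ∃ i p, Even p ∧
      Persistent (Arena ok st nx) (ColEq c st i p) h₁ ∧
      ∀ M h, Reach (Arena ok st nx) h₁ h → ∃ h', Reach (Arena ok st nx) h h' ∧
        ∀ q, p < q → q ≤ M → Extinct (Arena ok st nx) (ColEq c st i q) h' := by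
  set E := Arena ok st nx
  suffices ∃ h₁, Reach E h₀ h₁ ∧ ∃ i p, Even p ∧ Persistent E (ColEq c st i p) h₁ ∧
      ∀ q, p < q → ∀ h, Reach E h₁ h → ¬ Persistent E (ColEq c st i q) h by
    obtain ⟨h₁, hr, i, p, hp, hpers, hq⟩ := this
    refine ⟨h₁, hr, i, p, hp, hpers, fun M => ?_⟩
    induction M with
    | zero => exact fun h _ => ⟨h, Reach.refl h, fun q h1 h2 => by omega⟩
    | succ M ih =>
      intro h hh
      obtain ⟨h', hr', he⟩ := ih h hh
      by_cases hM : p < M + 1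
      · obtain ⟨h'', hr'', he'⟩ := not_persistent (hq _ hM h' (hh.trans hr'))
        refine ⟨h'', hr'.trans hr'', fun q h1 h2 => ?_⟩
        rcases Nat.lt_succ_iff_lt_or_eq.1 (Nat.lt_succ_of_le h2) with h3 | rfl
        exacts [(he q h1 (by omega)).reach hr'', he']
      · exact ⟨h', hr', fun q h1 h2 => by omega⟩
  by_contra! hcon
  obtain ⟨s, hs⟩ := exists_surjective_nat (Bool × ℕ)
  obtain ⟨ρ, w, hρ, hE, hT, hD⟩ := exists_generic_play (E := E) (h₀ := h₀)
    (fun h hr => let ⟨a, ha⟩ := live h (hW.reach_mem hr h0); ⟨a, _, ha, rfl⟩)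
    (fun j => ColEq c st (s j).1 (s j).2)
    (fun j h => Even (s j).2 → Extinct E (ColEq c st (s j).1 (s j).2) h ∨
      ∃ q, (s j).2 < q ∧ Persistent E (ColEq c st (s j).1 q) h) (by
    intro j h hr
    by_cases hp : Even (s j).2
    · by_cases hpers : Persistent E (ColEq c st (s j).1 (s j).2) h
      · obtain ⟨q, hq, h', hr', hp'⟩ := hcon h hr _ _ hp hpers
        exact ⟨h', hr', fun _ => .inr ⟨q, hq, hp'⟩⟩
      · obtain ⟨h', hr', he⟩ := not_persistent hpers
        exact ⟨h', hr', fun _ => .inl he⟩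
    · exact ⟨h, Reach.refl h, fun h => absurd h hp⟩)
  obtain ⟨i, p, hp, hi, hm⟩ := hW.good ρ w (hρ ▸ h0) (fun n => (hE n).1) fun n => (hE n).2
  obtain ⟨j, hj⟩ := hs (i, p)
  obtain ⟨n, hn⟩ := hT j
  simp only [hj] at hn
  rcases hn hp with he | ⟨q, hq, hpers⟩
  · obtain ⟨m, hm, hc⟩ := hi n
    exact he _ (Reach.of_play hE hm) _ _ (hE m) hc
  · obtain ⟨j', hj'⟩ := hs (i, q)
    have := hD j' n (by simpa only [hj'] using hpers)
    simp only [hj'] at this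
    exact hm q hq this

theorem wins_singleton_of_dead {h : H} (hd : ∀ a, ¬ ok (st h) a) :
    Wins ok G c {st h} id fun r _ => r :=
  ⟨fun r hr _ _ => hr, fun r hr a ha => by subst hr; exact absurd ha (hd a),
    fun ρ w h0 ho _ => absurd (ho 0) (by simpa [Set.mem_singleton_iff.1 h0] using hd (w 0))⟩

open Classical in
/-- One step of the induction for bounded colours: if strategies avoiding the top colour of one
colouring can be made positional, a nonempty strategy contains a positional one. -/
theorem Wins.exists_positional_subset (hW : Wins ok G c K st nx) {h₀ : H} (h0 : h₀ ∈ K)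
    (m : Bool → ℕ) (hm : ∀ i r a r', G r a r' → c i r a r' < m i)
    (IH : ∀ i p, p < m i → ∀ (ok₁ : V → A → Prop) (G₁ : V → A → V → Prop) (K₁ : Set H),
      (∀ r a r', G₁ r a r' → G r a r' ∧ c i r a r' < p) → Wins ok₁ G₁ c K₁ st nx →
      ∃ X f, Wins ok₁ G₁ c X id f ∧ ∀ h ∈ K₁, st h ∈ X) :
    ∃ S f, Wins ok G c S id f ∧ ∃ h ∈ K, st h ∈ S := by
  by_cases hdead : ∃ h ∈ K, ∀ a, ¬ ok (st h) a
  · obtain ⟨h, hh, hd⟩ := hdead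
    exact ⟨_, _, wins_singleton_of_dead hd, h, hh, rfl⟩
  push Not at hdead
  obtain ⟨h₁, hr₁, i, p, hp, hpers, hext⟩ := hW.exists_persistent h0 hdead
  obtain ⟨h, hr, hext⟩ := hext (m i) h₁ (Reach.refl _)
  set E := Arena ok st nx
  have hh₁ : h₁ ∈ K := hW.reach_mem hr₁ h0
  have hh : h ∈ K := hW.reach_mem hr hh₁
  have hpm : p < m i := by
    obtain ⟨l, h', hl, ⟨x, b, y⟩, hx, hc⟩ := hpers.exists_walk
    obtain ⟨l₁, l₂, -, hl₁, -⟩ := hl.split hx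
    rw [← show c i (st x) b (st y) = p from hc]
    exact hm _ _ _ _ (hW.arena_edge (hW.reach_mem ⟨_, hl₁⟩ hh₁) (hl.edge _ hx))
  let K₁ : Set H := {k | Reach E h k}
  have hK₁ : K₁ ⊆ K := fun k hk => hW.reach_mem hk hh
  let S : Set V := st '' K₁
  let G₁ : V → A → V → Prop := fun r a r' => G r a r' ∧ c i r a r' ≤ p ∧ r' ∈ S
  let okT : V → A → Prop := fun r a => ok r a ∧ ∀ r', G₁ r a r' → c i r a r' ≠ p
  let G₂ : V → A → V → Prop := fun r a r' => G₁ r a r' ∧ c i r a r' < p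
  have hcl : ∀ k ∈ K₁, ∀ a, ok (st k) a → nx k a ∈ K₁ := fun k hk a ha =>
    Reach.trans hk (Reach.step ⟨ha, rfl⟩)
  have hG₁ : ∀ k ∈ K₁, ∀ a, ok (st k) a → G₁ (st k) a (st (nx k a)) := by
    intro k hk a ha
    have hG := hW.edge k (hK₁ hk) a ha
    refine ⟨hG, ?_, _, hcl k hk a ha, rfl⟩
    by_contra! hlt
    exact hext _ hlt (hm _ _ _ _ hG).le k hk a _ ⟨ha, rfl⟩ rfl
  have hW₂ : Wins okT G₂ c K₁ st nx :=
    ⟨fun k hk a ha => hcl k hk a ha.1,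
      fun k hk a ha => ⟨hG₁ k hk a ha.1, lt_of_le_of_ne (hG₁ k hk a ha.1).2.1
        (ha.2 _ (hG₁ k hk a ha.1))⟩,
      fun ρ w h0 ho => hW.good ρ w (hK₁ h0) fun n => (ho n).1⟩
  obtain ⟨X, g, hg, hKX⟩ := IH i p hpm okT G₂ K₁ (fun r a r' h => ⟨h.1.1, h.2⟩) hW₂
  have hSX : S ⊆ X := by rintro _ ⟨k, hk, rfl⟩; exact hKX k hk
  let f : V → A → V := fun r a => if h : ∃ r', G₁ r a r' ∧ c i r a r' = p then h.choose else g r a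
  have hf₁ : ∀ r a, (∃ r', G₁ r a r' ∧ c i r a r' = p) →
      G₁ r a (f r a) ∧ c i r a (f r a) = p := by
    intro r a h
    simp only [f, dif_pos h]
    exact h.choose_spec
  have hf₂ : ∀ r a, ¬ (∃ r', G₁ r a r' ∧ c i r a r' = p) → f r a = g r a := fun r a h => dif_neg h
  have hokT : ∀ r a, ok r a → ¬ (∃ r', G₁ r a r' ∧ c i r a r' = p) → okT r a :=
    fun r a ha h => ⟨ha, fun r' hr' hc => h ⟨r', hr', hc⟩⟩
  have hfG : ∀ r ∈ S, ∀ a, ok r a → G₁ r a (f r a) := by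
    intro r hr a ha
    by_cases h : ∃ r', G₁ r a r' ∧ c i r a r' = p
    · exact (hf₁ r a h).1
    · rw [hf₂ r a h]
      exact (hg.edge r (hSX hr) a (hokT r a ha h)).1
  refine ⟨S, f, ⟨fun r hr a ha => (hfG r hr a ha).2.2, fun r hr a ha => (hfG r hr a ha).1,
    fun ρ w h0 ho hn => ?_⟩, h, hh, h, Reach.refl h, rfl⟩
  simp only [id] at ho ⊢
  have hS : ∀ n, ρ n ∈ S := by
    intro n
    induction n with
    | zero => exact h0
    | succ n ih => rw [hn]; exact (hfG _ ih _ (ho n)).2.2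
  have hle : ∀ n, c i (ρ n) (w n) (ρ (n + 1)) ≤ p := fun n => by
    rw [hn]; exact (hfG _ (hS n) _ (ho n)).2.1
  by_cases hinf : InfOften fun n => c i (ρ n) (w n) (ρ (n + 1)) = p
  · exact ⟨i, (parityAcc_iff_even hinf fun n (_ : 0 ≤ n) => hle n).2 hp⟩
  · obtain ⟨N, hN⟩ := not_infOften.1 hinf
    have hno : ∀ n, N ≤ n → ¬ ∃ r', G₁ (ρ n) (w n) r' ∧ c i (ρ n) (w n) r' = p :=
      fun n hNn h => hN n hNn (by rw [hn]; exact (hf₁ _ _ h).2)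
    refine Good.of_shift N (hg.good (fun n => ρ (n + N)) (fun n => w (n + N)) (hSX (hS _))
      (fun n => hokT _ _ (ho _) (hno _ (by omega))) fun n => ?_)
    rw [add_right_comm, hn, hf₂ _ _ (hno _ (by omega))]

/-- For bounded colours, every strategy can be made positional. -/
theorem Wins.exists_positional_of_bounded [Finite V] (s : ℕ) :
    ∀ (m : Bool → ℕ), m true + m false = s →
    ∀ (ok : V → A → Prop) (G : V → A → V → Prop) (K : Set H),
      (∀ i r a r', G r a r' → c i r a r' < m i) → Wins ok G c K st nx →
      ∃ X f, Wins ok G c X id f ∧ ∀ h ∈ K, st h ∈ X := by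
  induction s using Nat.strong_induction_on with
  | _ s IH =>
    intro m hs ok G K hm hW
    obtain ⟨X, f, hX, hmax⟩ := exists_maximal_positional ok G c
    refine ⟨X, f, hX, fun h hh => ?_⟩
    by_contra hhX
    obtain ⟨S, g, hS, h', hh', hS'⟩ := (hW.diff X).exists_positional_subset (h₀ := h) ⟨hh, hhX⟩ m hm
      fun i p hp ok₁ G₁ K₁ hG₁ hW₁ => by
        refine IH _ ?_ (Function.update m i p) rfl ok₁ G₁ K₁ (fun j r a r' hg => ?_) hW₁
        · cases i <;> simp [Function.update] <;> omega
        · by_cases hj : j = i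
          · subst hj; simpa using (hG₁ r a r' hg).2
          · simpa [Function.update_of_ne hj] using hm j r a r' (hG₁ r a r' hg).1
    exact hh'.2 (hmax S g hS hS')

end Strategies

/-! ### Auxiliary finiteness facts -/

theorem exists_representatives {A T : Type} [Finite T] (F : A → T) :
    ∃ rep : A → A, (Set.range rep).Finite ∧ ∀ a, F (rep a) = F a := by
  choose g hg using fun t : Set.range F => t.2
  refine ⟨fun a => g ⟨F a, a, rfl⟩, (Set.finite_range g).subset ?_, fun a => hg _⟩
  rintro _ ⟨a, rfl⟩
  exact ⟨_, rfl⟩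

/-- Along a subsequence, each of finitely many sequences is bounded or tends to infinity. -/
theorem exists_gap {T : Type*} [Finite T] (val : ℕ → T → ℕ) :
    ∃ b, ∀ N, ∃ N', N ≤ N' ∧ ∀ t, val N' t ≤ b ∨ N < val N' t := by
  have := Fintype.ofFinite T
  suffices ∀ s : Finset T, ∃ b, ∀ N, ∃ N', N ≤ N' ∧ ∀ t ∈ s, val N' t ≤ b ∨ N < val N' t by
    simpa using this Finset.univ
  classical
  intro s
  induction s using Finset.induction_on with
  | empty => exact ⟨0, fun N => ⟨N, le_rfl, by simp⟩⟩
  | insert t s _ ih =>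
    obtain ⟨b, hb⟩ := ih
    by_cases hbd : ∃ b', ∀ N, ∃ N', N ≤ N' ∧ (∀ t ∈ s, val N' t ≤ b ∨ N < val N' t) ∧ val N' t ≤ b'
    · obtain ⟨b', hb'⟩ := hbd
      refine ⟨max b b', fun N => ?_⟩
      obtain ⟨N', hN, hs, ht⟩ := hb' N
      refine ⟨N', hN, fun u hu => ?_⟩
      rcases Finset.mem_insert.1 hu with rfl | hu
      · exact .inl (ht.trans (le_max_right _ _))
      · exact (hs u hu).imp_left fun h => h.trans (le_max_left _ _)
    · push Not at hbd
      refine ⟨b, fun M => ?_⟩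
      obtain ⟨N, hN⟩ := hbd M
      obtain ⟨N', hN', hs⟩ := hb (max N M)
      have hs' : ∀ K, K ≤ max N M → ∀ t ∈ s, val N' t ≤ b ∨ K < val N' t := fun K hK t ht =>
        (hs t ht).imp_right fun h => hK.trans_lt h
      refine ⟨N', (le_max_right _ _).trans hN', fun u hu => ?_⟩
      rcases Finset.mem_insert.1 hu with rfl | hu
      · exact .inr (hN N' ((le_max_left _ _).trans hN') (hs' N (le_max_left _ _)))
      · exact hs' M (le_max_right _ _) u hu

namespace Walk

variable {V A : Type} {E : V → A → V → Prop}

theorem reach_source {u v : V} {l : List (V × A × V)} (h : Walk E u l v) {x : V × A × V}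
    (hx : x ∈ l) : Reach E u x.1 :=
  let ⟨_, _, _, h₁, _⟩ := h.split hx
  ⟨_, h₁⟩

theorem map_edges {u v : V} {l : List (V × A × V)} (h : Walk E u l v)
    (g : V × A × V → V × A × V) (hg : ∀ x ∈ l, (g x).1 = x.1 ∧ (g x).2.2 = x.2.2 ∧
      E (g x).1 (g x).2.1 (g x).2.2) : Walk E u (l.map g) v := by
  induction h with
  | nil => exact .nil _
  | @cons u a v v' l he hw ih =>
    obtain ⟨h1, h2, h3⟩ := hg _ List.mem_cons_self
    have hw' := ih fun x hx => hg x (List.mem_cons_of_mem _ hx)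
    rw [List.map_cons]
    generalize g (u, a, v) = y at h1 h2 h3
    obtain ⟨y₁, y₂, y₃⟩ := y
    simp only at h1 h2 h3
    subst h1 h2
    exact .cons h3 hw'

open Classical in
/-- A walk can be changed to use at most one edge between any two vertices, in addition to a
prescribed edge. -/
theorem reduce {u v : V} {l : List (V × A × V)} (h : Walk E u l v) {x : V × A × V} (hx : x ∈ l) :
    ∃ (l' : List (V × A × V)) (t : Option (V × V) → V × A × V), Walk E u l' v ∧ x ∈ l' ∧
      (∀ y ∈ l', y ∈ l) ∧ ∀ y ∈ l', ∃ o, t o = y := by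
  obtain ⟨l₁, l₂, rfl, h₁, h₂⟩ := h.split hx
  let l := l₁ ++ x :: l₂
  let t : V × V → V × A × V := fun vv =>
    if h : ∃ y ∈ l, (y.1, y.2.2) = vv then h.choose else x
  have ht : ∀ y ∈ l, t (y.1, y.2.2) ∈ l ∧
      ((t (y.1, y.2.2)).1, (t (y.1, y.2.2)).2.2) = (y.1, y.2.2) := by
    intro y hy
    have hex : ∃ z ∈ l, (z.1, z.2.2) = (y.1, y.2.2) := ⟨y, hy, rfl⟩
    simp only [t, dif_pos hex]
    exact hex.choose_spec
  let g : V × A × V → V × A × V := fun y => t (y.1, y.2.2)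
  have hg : ∀ y ∈ l, (g y).1 = y.1 ∧ (g y).2.2 = y.2.2 ∧ E (g y).1 (g y).2.1 (g y).2.2 :=
    fun y hy => ⟨(Prod.ext_iff.1 (ht y hy).2).1, (Prod.ext_iff.1 (ht y hy).2).2,
      h.edge _ (ht y hy).1⟩
  have hx' := h.edge x hx
  refine ⟨l₁.map g ++ x :: l₂.map g, fun o => o.elim x t,
    (h₁.map_edges g fun y hy => hg y (by simp [l, hy])).append
      (.cons hx' (h₂.map_edges g fun y hy => hg y (by simp [l, hy]))), by simp, ?_, ?_⟩
  · intro y hy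
    rcases List.mem_append.1 hy with hy | hy
    · obtain ⟨z, hz, rfl⟩ := List.mem_map.1 hy
      exact (ht z (by simp [l, hz])).1
    · rcases List.mem_cons.1 hy with rfl | hy
      · exact hx
      · obtain ⟨z, hz, rfl⟩ := List.mem_map.1 hy
        exact (ht z (by simp [l, hz])).1
  · intro y hy
    rcases List.mem_append.1 hy with hy | hy
    · obtain ⟨z, hz, rfl⟩ := List.mem_map.1 hy
      exact ⟨some (z.1, z.2.2), rfl⟩
    · rcases List.mem_cons.1 hy with rfl | hy
      · exact ⟨none, rfl⟩
      · obtain ⟨z, hz, rfl⟩ := List.mem_map.1 hy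
        exact ⟨some (z.1, z.2.2), rfl⟩

/-- Closed walks with arbitrarily large even maximum of `c₂` and `c₁ ≤ p`, together with closed
walks through colour `p` of `c₁` avoiding larger and larger intervals of colours above `p`, can be
combined to a play accepted by both colourings. -/
theorem exists_accepting_play [Finite V] {c₁ c₂ : V × A × V → ℕ} {p : ℕ} (hp : Even p) {r : V}
    (hx : ∀ k, ∃ l, Walk E r l r ∧ (∀ x ∈ l, c₁ x ≤ p) ∧
      ∃ e, Even e ∧ k < e ∧ (∀ x ∈ l, c₂ x ≤ e) ∧ ∃ x ∈ l, c₂ x = e)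
    (hy : ∀ N, ∃ l, Walk E r l r ∧ (∃ x ∈ l, c₁ x = p) ∧ ∀ x ∈ l, c₁ x ≤ p ∨ N < c₁ x) :
    ∃ (ρ : ℕ → V) (w : ℕ → A), ρ 0 = r ∧ (∀ n, E (ρ n) (w n) (ρ (n + 1))) ∧
      (ParityAcc fun n => c₁ (ρ n, w n, ρ (n + 1))) ∧
      ParityAcc fun n => c₂ (ρ n, w n, ρ (n + 1)) := by
  have hy' : ∀ N, ∃ (l : List (V × A × V)) (t : Option (V × V) → V × A × V), Walk E r l r ∧
      (∃ x ∈ l, c₁ x = p) ∧ (∀ x ∈ l, c₁ x ≤ p ∨ N < c₁ x) ∧ ∀ x ∈ l, ∃ o, t o = x := by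
    intro N
    obtain ⟨l, hl, ⟨x, hx, hxp⟩, hN⟩ := hy N
    obtain ⟨l', t, hl', hx', hsub, ht⟩ := hl.reduce hx
    exact ⟨l', t, hl', ⟨x, hx', hxp⟩, fun z hz => hN z (hsub z hz), ht⟩
  choose y t hy hyp hyN ht using hy'
  obtain ⟨b, hb⟩ := exists_gap fun N o => c₂ (t N o)
  choose g hgN hg using hb
  obtain ⟨x, hx, hxp, e, he, hbe, hxe, hxe'⟩ := hx b
  obtain ⟨ρ, w, h0, hE, hev, hhit⟩ := Walk.concat (v := fun _ => r) (l := fun j => x ++ y (g j))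
    (fun j => hx.append (hy (g j))) (fun j h => by
      obtain ⟨z, hz, -⟩ := hxe'
      simp_all)
  refine ⟨ρ, w, h0, hE, ⟨p, hp, fun N => ?_, fun q hq hi => ?_⟩, ⟨e, he, fun N => ?_, fun q hq hi => ?_⟩⟩
  · obtain ⟨z, hz, hzp⟩ := hyp (g N)
    obtain ⟨n, hn, rfl⟩ := hhit N z (List.mem_append_right _ hz)
    exact ⟨n, hn, hzp⟩
  · obtain ⟨N, hN⟩ := hev q
    obtain ⟨n, hn, rfl : c₁ _ = q⟩ := hi N
    obtain ⟨j, hj, hmem⟩ := hN n hn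
    rcases List.mem_append.1 hmem with h | h
    · exact absurd (hxp _ h) (by omega)
    · have h1 := hyN _ _ h
      have h2 := hgN j
      omega
  · obtain ⟨z, hz, hze⟩ := hxe'
    obtain ⟨n, hn, rfl⟩ := hhit N z (List.mem_append_left _ hz)
    exact ⟨n, hn, hze⟩
  · obtain ⟨N, hN⟩ := hev q
    obtain ⟨n, hn, rfl : c₂ _ = q⟩ := hi N
    obtain ⟨j, hj, hmem⟩ := hN n hn
    rcases List.mem_append.1 hmem with h | h
    · exact absurd (hxe _ h) (by omega)
    · obtain ⟨o, ho⟩ := ht _ _ h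
      have := hg j o
      rw [ho] at this
      omega

end Walk

/-! ### Positional determinacy for two incompatible parity conditions -/

section Incompatible

variable {V A H : Type} {ok : V → A → Prop} {G : V → A → V → Prop} {c : Bool → V → A → V → ℕ}
  {K : Set H} {st : H → V} {nx : H → A → H}

def capColors (k : ℕ) (c : Bool → V → A → V → ℕ) : Bool → V → A → V → ℕ :=
  fun i r a r' => cap k (c i r a r')

theorem Wins.of_good {c' : Bool → V → A → V → ℕ} (hW : Wins ok G c K st nx)
    (h : ∀ ρ w, Good c ρ w → Good c' ρ w) : Wins ok G c' K st nx :=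
  ⟨hW.closed, hW.edge, fun ρ w h0 ho hn => h _ _ (hW.good ρ w h0 ho hn)⟩

theorem Good.cap_mono {k k' : ℕ} (hk : k ≤ k') {ρ : ℕ → V} {w : ℕ → A}
    (h : Good (capColors k c) ρ w) : Good (capColors k' c) ρ w :=
  h.imp fun _ => parityAcc_cap_mono hk

theorem Good.of_cap {k : ℕ} {ρ : ℕ → V} {w : ℕ → A} (h : Good (capColors k c) ρ w) :
    Good c ρ w :=
  h.imp fun _ => parityAcc_of_cap

/-- From some bound on, the largest positionally winning set for the capped colours is constant. -/
theorem exists_stable_positional [Finite V] (ok : V → A → Prop) (G : V → A → V → Prop)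
    (c : Bool → V → A → V → ℕ) : ∃ k₀ X f, Wins ok G c X id f ∧
      ∀ k, k₀ ≤ k → ∀ S g, Wins (Avoids ok G X) G (capColors k c) S id g → S ⊆ X := by
  choose X f hX hmax using fun k => exists_maximal_positional ok G (capColors k c)
  have hmono : Monotone X := fun k k' hk => hmax k' _ (f k)
    (((hX k).of_good fun _ _ => Good.cap_mono hk).anti fun _ _ h => h.1)
  obtain ⟨k₀, hk₀⟩ := WellFoundedGT.monotone_chain_condition ⟨X, hmono⟩
  refine ⟨k₀, X k₀, f k₀, (hX k₀).of_good fun _ _ => Good.of_cap, fun k hk S g hS => ?_⟩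
  have : X k₀ = X k := hk₀ k hk
  rw [this] at hS ⊢
  exact hmax k S g hS

/-- Finitely many letters represent all letters, as far as edges and capped colours matter. -/
theorem exists_finite_letters [Finite V] (G : V → A → V → Prop) (c : Bool → V → A → V → ℕ)
    (k : ℕ) : ∃ rep : A → A, (Set.range rep).Finite ∧
      (∀ a r r', G r (rep a) r' ↔ G r a r') ∧
      ∀ a i r r', capColors k c i r (rep a) r' = capColors k c i r a r' := by
  obtain ⟨rep, hfin, hrep⟩ := exists_representatives (A := A)
    fun (a : A) (r r' : V) => ((G r a r' : Prop),
      fun i => (⟨capColors k c i r a r', Nat.lt_succ_of_le (cap_le _ _)⟩ : Fin (2 * k + 2)))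
  have h := fun a r r' => Prod.ext_iff.1 (congrFun (congrFun (hrep a) r) r')
  exact ⟨rep, hfin, fun a r r' => iff_of_eq (h a r r').1,
    fun a i r r' => congrArg Fin.val (congrFun (h a r r').2 i)⟩

/-- A strategy winning for capped colours on representative letters yields a positional one. -/
theorem Wins.exists_positional_of_representatives [Finite V] {k : ℕ} {rep : A → A}
    (hG : ∀ a r r', G r (rep a) r' ↔ G r a r')
    (hc : ∀ a i r r', capColors k c i r (rep a) r' = capColors k c i r a r')
    (hok : ∀ r a, ok r a → ok r (rep a))
    (hW : Wins (fun r a => ok r a ∧ a ∈ Set.range rep) G (capColors k c) K st nx) :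
    ∃ S g, Wins ok G (capColors k c) S id g ∧ ∀ h ∈ K, st h ∈ S := by
  obtain ⟨S, g, hg, hS⟩ := Wins.exists_positional_of_bounded _ (fun _ => 2 * k + 2) rfl _ _ _
    (fun i r a r' _ => Nat.lt_succ_of_le (cap_le _ _)) hW
  refine ⟨S, fun r a => g r (rep a), ⟨fun r hr a ha => hg.closed r hr _ ⟨hok _ _ ha, a, rfl⟩,
    fun r hr a ha => (hG _ _ _).1 (hg.edge r hr _ ⟨hok _ _ ha, a, rfl⟩), fun ρ w h0 ho hn => ?_⟩, hS⟩
  obtain ⟨i, hi⟩ := hg.good ρ (fun n => rep (w n)) h0 (fun n => ⟨hok _ _ (ho n), w n, rfl⟩) hn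
  exact ⟨i, parityAcc_of_eventually_eq hi (N := 0) fun n _ => hc _ _ _ _⟩

theorem exists_bound_on_letters [Finite V] (c : Bool → V → A → V → ℕ) {F : Set A} (hF : F.Finite) :
    ∃ M, ∀ i r, ∀ a ∈ F, ∀ r', c i r a r' ≤ M := by
  have hfin : (Set.range fun x : Bool × V × F × V => c x.1 x.2.1 x.2.2.1 x.2.2.2).Finite :=
    have := hF.to_subtype
    Set.finite_range _
  obtain ⟨M, hM⟩ := hfin.bddAbove
  exact ⟨M, fun i r a ha r' => hM ⟨(i, r, ⟨a, ha⟩, r'), rfl⟩⟩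

/-- A play with bounded colours that is accepting, but not after capping the colours at `k`,
contains a closed walk whose largest colour is even and exceeds `k`. -/
theorem exists_loop_of_accepting [Finite V] {E : V → A → V → Prop} {ρ : ℕ → V} {w : ℕ → A}
    (hE : ∀ n, E (ρ n) (w n) (ρ (n + 1))) {d : V × A × V → ℕ} {k M : ℕ}
    (hM : ∀ n, d (ρ n, w n, ρ (n + 1)) ≤ M)
    (hacc : ParityAcc fun n => d (ρ n, w n, ρ (n + 1)))
    (hcap : ¬ ParityAcc fun n => cap k (d (ρ n, w n, ρ (n + 1)))) :
    ∃ n l, Walk E (ρ n) l (ρ n) ∧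
      (∀ x ∈ l, ∃ i, x = (ρ i, w i, ρ (i + 1))) ∧
      ∃ e, Even e ∧ k < e ∧ (∀ x ∈ l, d x ≤ e) ∧ ∃ x ∈ l, d x = e := by
  obtain ⟨e, he, hi, hm⟩ := hacc
  obtain ⟨N, hN⟩ := eventually_le_of_bounded hM hm
  obtain ⟨r, hr⟩ := infOften_pigeonhole ρ hi
  obtain ⟨n, hn, hne, rfl⟩ := hr N
  obtain ⟨n', hn', -, hr'⟩ := hr (n + 1)
  obtain ⟨l, hl, hx⟩ := Walk.of_play hE n (n' - n)
  rw [show n + (n' - n) = n' by omega] at hl hx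
  refine ⟨n, l, by rwa [hr'] at hl, fun x h => ?_, e, he, ?_, fun x h => ?_, _,
    (hx _).2 ⟨n, le_rfl, by omega, rfl⟩, hne⟩
  · obtain ⟨i, -, -, rfl⟩ := (hx x).1 h
    exact ⟨i, rfl⟩
  · by_contra! hk
    exact hcap (parityAcc_cap.2 ⟨e, he, hk, hi, N, hN⟩)
  · obtain ⟨i, h1, -, rfl⟩ := (hx x).1 h
    exact hN i (by omega)

/-- From some vertex on, the projection of the set of reachable vertices is constant. -/
theorem exists_stable_reach [Finite V] (E : H → A → H → Prop) (st : H → V) (h₁ : H) :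
    ∃ h₂, Reach E h₁ h₂ ∧ ∀ h, Reach E h₂ h → ∀ r, (∃ h', Reach E h₂ h' ∧ st h' = r) →
      ∃ h', Reach E h h' ∧ st h' = r := by
  let R : H → Set V := fun h => {r | ∃ h', Reach E h h' ∧ st h' = r}
  have hanti : ∀ {h h'}, Reach E h h' → R h' ⊆ R h := fun hr r ⟨k, hk, hs⟩ => ⟨k, hr.trans hk, hs⟩
  obtain ⟨_, ⟨h₂, hr₂, rfl⟩, hmin⟩ := (Set.toFinite (R '' {h | Reach E h₁ h})).exists_minimal
    ⟨_, h₁, Reach.refl h₁, rfl⟩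
  exact ⟨h₂, hr₂, fun h hr r hR => hmin ⟨h, hr₂.trans hr, rfl⟩ (hanti hr) hR⟩

/-- If no path of the graph is accepted by both colourings, a strategy for the disjunction of the
two parity conditions can be made positional, over any alphabet and for unbounded colours. -/
theorem Wins.exists_positional [Finite V] (hW : Wins (fun _ _ => True) G c K st nx)
    (dis : ∀ h ∈ K, ∀ (ρ : ℕ → V) (w : ℕ → A), ρ 0 = st h →
      (∀ n, G (ρ n) (w n) (ρ (n + 1))) →
      ¬ ∀ i, ParityAcc fun n => c i (ρ n) (w n) (ρ (n + 1))) {h₀ : H} (h0 : h₀ ∈ K) :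
    ∃ X f, Wins (fun _ _ => True) G c X id f ∧ st h₀ ∈ X := by
  obtain ⟨k₀, X, f, hX, hmax⟩ := exists_stable_positional (fun _ _ => True) G c
  refine ⟨X, f, hX, ?_⟩
  by_contra hX0
  let okA : V → A → Prop := Avoids (fun _ _ => True) G X
  have hW' : Wins okA G c {h | h ∈ K ∧ st h ∉ X} st nx := hW.diff X
  set K' : Set H := {h | h ∈ K ∧ st h ∉ X} with hK'
  have live : ∀ h ∈ K', ∃ a, okA (st h) a := by
    intro h hh
    by_contra! hd
    exact hh.2 (hmax k₀ le_rfl _ _ (wins_singleton_of_dead hd) rfl)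
  set E := Arena okA st nx
  obtain ⟨h₁, hr₁, i, p, hp, hpers, hext⟩ := hW'.exists_persistent ⟨h0, hX0⟩ live
  obtain ⟨h₂, hr₂, hstable⟩ := exists_stable_reach E st h₁
  have hK₂ : ∀ h, Reach E h₂ h → h ∈ K' := fun h hr =>
    hW'.reach_mem (hr₁.trans (hr₂.trans hr)) ⟨h0, hX0⟩
  have loops : ∀ k, k₀ ≤ k → p ≤ k → ∃ r, (∃ h, Reach E h₂ h ∧ st h = r) ∧ ∃ l, Walk G r l r ∧
      (∀ x ∈ l, c i x.1 x.2.1 x.2.2 ≤ p) ∧ ∃ e, Even e ∧ k < e ∧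
        (∀ x ∈ l, c (!i) x.1 x.2.1 x.2.2 ≤ e) ∧ ∃ x ∈ l, c (!i) x.1 x.2.1 x.2.2 = e := by
    intro k hk hpk
    obtain ⟨rep, hfin, hG, hc⟩ := exists_finite_letters G c k
    obtain ⟨M, hM⟩ := exists_bound_on_letters c hfin
    obtain ⟨h₃, hr₃, hq⟩ := hext M h₂ hr₂
    let K₃ : Set H := {h | Reach E h₃ h}
    have hK₃ : K₃ ⊆ K' := fun h hr => hK₂ h (hr₃.trans hr)
    have hnot : ¬ Wins (fun r a => okA r a ∧ a ∈ Set.range rep) G (capColors k c) K₃ st nx := by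
      intro hcap
      obtain ⟨S, g, hS, hmem⟩ := hcap.exists_positional_of_representatives hG hc fun r a ha =>
        ⟨trivial, fun r' hr' hg => ha.2 r' hr' ((hG _ _ _).1 hg)⟩
      exact (hK₂ _ hr₃).2 (hmax k hk S g hS (hmem h₃ (Reach.refl _)))
    have hex : ∃ (ρ : ℕ → H) (w : ℕ → A), ρ 0 ∈ K₃ ∧
        (∀ n, okA (st (ρ n)) (w n) ∧ w n ∈ Set.range rep) ∧ (∀ n, ρ (n + 1) = nx (ρ n) (w n)) ∧
        ¬ Good (capColors k c) (fun n => st (ρ n)) w := by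
      by_contra! hcon
      exact hnot ⟨fun h hh a ha => Reach.trans hh (Reach.step ⟨ha.1, rfl⟩),
        fun h hh a ha => hW'.edge h (hK₃ hh) a ha.1, hcon⟩
    obtain ⟨ρ, w, hρ0, ho, hn, hbad⟩ := hex
    have hEρ : ∀ n, E (ρ n) (w n) (ρ (n + 1)) := fun n => ⟨(ho n).1, hn n⟩
    have hKρ : ∀ n, Reach E h₃ (ρ n) := fun n =>
      Reach.trans hρ0 (Reach.of_play hEρ (Nat.zero_le n))
    have hGρ : ∀ n, G (st (ρ n)) (w n) (st (ρ (n + 1))) := fun n =>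
      hW'.arena_edge (hK₃ (hKρ n)) (hEρ n)
    have hB : ∀ j n, c j (st (ρ n)) (w n) (st (ρ (n + 1))) ≤ M := fun j n =>
      hM _ _ _ (ho n).2 _
    have hle : ∀ n, c i (st (ρ n)) (w n) (st (ρ (n + 1))) ≤ p := by
      intro n
      by_contra! hlt
      exact hq _ hlt (hB i n) _ (hKρ n) _ _ (hEρ n) rfl
    have hrej : ¬ ParityAcc fun n => c i (st (ρ n)) (w n) (st (ρ (n + 1))) := by
      rintro ⟨q, hqe, hqi, hqm⟩
      have hqp : q ≤ p := by
        obtain ⟨n, -, rfl⟩ := hqi 0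
        exact hle n
      exact hbad ⟨i, parityAcc_cap.2 ⟨q, hqe, hqp.trans hpk, hqi,
        eventually_le_of_bounded (hB i) hqm⟩⟩
    have hacc : ParityAcc fun n => c (!i) (st (ρ n)) (w n) (st (ρ (n + 1))) := by
      obtain ⟨j, hj⟩ := hW'.good ρ w (hK₃ hρ0) (fun n => (ho n).1) hn
      rcases Bool.eq_or_eq_not j i with rfl | rfl
      exacts [absurd hj hrej, hj]
    obtain ⟨n, l, hl, hx, e, he⟩ := exists_loop_of_accepting (ρ := fun n => st (ρ n))
      (d := fun x => c (!i) x.1 x.2.1 x.2.2) hGρ (hB _) hacc fun h => hbad ⟨!i, h⟩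
    refine ⟨_, ⟨ρ n, hr₃.trans (hKρ n), rfl⟩, l, hl, fun x h => ?_, e, he⟩
    obtain ⟨j, rfl⟩ := hx x h
    exact hle j
  choose r hr hloop using fun k => loops (max (max k₀ p) k) (by omega) (by omega)
  obtain ⟨r₀, hr₀⟩ := infOften_pigeonhole r (p := fun _ => True) fun N => ⟨N, le_rfl, trivial⟩
  have hrr : ∃ h, Reach E h₂ h ∧ st h = r₀ := by
    obtain ⟨n, -, -, rfl⟩ := hr₀ 0
    exact hr n
  obtain ⟨ρ, w, hρ0, hE, hacc₁, hacc₂⟩ := Walk.exists_accepting_play (E := G)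
    (c₁ := fun x => c i x.1 x.2.1 x.2.2) (c₂ := fun x => c (!i) x.1 x.2.1 x.2.2) hp (r := r₀)
    (fun k => by
      obtain ⟨n, hn, -, rfl⟩ := hr₀ k
      obtain ⟨l, hl, hle, e, he, hke, hrest⟩ := hloop n
      exact ⟨l, hl, hle, e, he, by omega, hrest⟩)
    (fun N => by
      obtain ⟨h₃, hr₃, hq⟩ := hext N h₂ hr₂
      obtain ⟨h₄, hr₄, hst₄⟩ := hstable h₃ hr₃ r₀ hrr
      obtain ⟨l₅, h₅, hl₅, x, hx, hxp⟩ :=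
        (hpers.reach (hr₂.trans (hr₃.trans hr₄))).exists_walk
      have hr₅ : Reach E h₃ h₅ := hr₄.trans ⟨_, hl₅⟩
      obtain ⟨h₆, ⟨l₆, hl₆⟩, hst₆⟩ := hstable h₅ (hr₃.trans hr₅) r₀ hrr
      have hl := hl₅.append hl₆
      have hreach : ∀ x ∈ l₅ ++ l₆, Reach E h₃ x.1 := fun x hx => hr₄.trans (hl.reach_source hx)
      have hGl : Walk G (st h₄) ((l₅ ++ l₆).map fun x => (st x.1, x.2.1, st x.2.2)) (st h₆) :=
        (hl.mono (E' := fun h a h' => G (st h) a (st h')) fun x hx he =>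
          hW'.arena_edge (hK₂ _ (hr₃.trans (hreach x hx))) he).map st fun _ _ _ h => h
      rw [hst₄, hst₆] at hGl
      refine ⟨_, hGl, ⟨_, List.mem_map_of_mem (List.mem_append_left _ hx), hxp⟩, ?_⟩
      rintro _ hmem
      obtain ⟨y, hy, rfl⟩ := List.mem_map.1 hmem
      by_contra! hcon
      exact hq _ hcon.1 hcon.2 _ (hreach y hy) _ _ (hl.edge y hy) rfl)
  obtain ⟨h, hr, rfl⟩ := hrr
  refine dis h (hK₂ h hr).1 ρ w hρ0 hE fun j => ?_
  rcases Bool.eq_or_eq_not j i with rfl | rfl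
  exacts [hacc₁, hacc₂]

end Incompatible

/-! ### The product of two good-for-games automata -/

/-- The sequence `x` followed by `s`. -/
def seqCons {T : Type} (x : T) (s : ℕ → T) : ℕ → T
  | 0 => x
  | n + 1 => s n

theorem Walk.prepend {V A : Type} {E : V → A → V → Prop} {u v : V} {l : List (V × A × V)}
    (h : Walk E u l v) {ρ : ℕ → V} {w : ℕ → A} (h0 : ρ 0 = v)
    (hE : ∀ n, E (ρ n) (w n) (ρ (n + 1))) :
    ∃ (ρ' : ℕ → V) (w' : ℕ → A) (k : ℕ), ρ' 0 = u ∧ (∀ n, E (ρ' n) (w' n) (ρ' (n + 1))) ∧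
      (∀ n, ρ' (n + k) = ρ n) ∧ ∀ n, w' (n + k) = w n := by
  induction h with
  | nil => exact ⟨ρ, w, 0, h0, hE, fun _ => rfl, fun _ => rfl⟩
  | @cons u a v v' l he _ ih =>
    obtain ⟨ρ', w', k, h0', hE', hρ, hw⟩ := ih h0
    refine ⟨seqCons u ρ', seqCons a w', k + 1, rfl, fun n => ?_,
      fun n => hρ n, fun n => hw n⟩
    cases n with
    | zero => simpa [seqCons, h0'] using he
    | succ n => exact hE' n

theorem reach_of_prefix_strategy {V A : Type} {E : V → A → V → Prop} {F : List A → V}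
    (hF : ∀ u a, E (F u) a (F (u ++ [a]))) (u : List A) : Reach E (F []) (F u) := by
  induction u using List.reverseRecOn with
  | nil => exact Reach.refl _
  | append_singleton u a ih => exact ih.trans (Reach.step (hF u a))

@[simp]
theorem pref_zero {A : Type} (w : ℕ → A) : pref w 0 = [] := rfl

theorem pref_succ {A : Type} (w : ℕ → A) (n : ℕ) : pref w (n + 1) = pref w n ++ [w n] := by
  unfold pref
  rw [List.ofFn_succ_last]
  rfl

theorem pref_map {A B : Type} (g : A → B) (w : ℕ → A) (n : ℕ) :
    pref (fun i => g (w i)) n = (pref w n).map g := by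
  simp [pref, List.map_ofFn, Function.comp_def]

theorem pref_cons {A : Type} (a : A) (w : ℕ → A) (n : ℕ) :
    pref (seqCons a w) (n + 1) = a :: pref w n := by
  simp [pref, List.ofFn_succ, seqCons]

theorem exists_dpa_of_gfg {A P P' : Type} [Finite P] [Finite P'] {L : Set (ℕ → A)} {N : NPA A P}
    {N' : NPA A P'} (hN : ∀ w, N.Accepts w ↔ w ∈ L) (hN' : ∀ w, N'.Accepts w ↔ w ∉ L)
    (hgfg : N.GFG) (hgfg' : N'.GFG) :
    ∃ D : DPA A (P × P'), ∀ w, D.Accepts w ↔ w ∈ L := by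
  obtain ⟨f₁, hf0₁, hfs₁, hf₁⟩ := hgfg
  obtain ⟨f₂, hf0₂, hfs₂, hf₂⟩ := hgfg'
  let G : P × P' → A → P × P' → Prop := fun r a r' => r'.1 ∈ N.Δ r.1 a ∧ r'.2 ∈ N'.Δ r.2 a
  let c : Bool → P × P' → A → P × P' → ℕ := fun i r a r' =>
    if i then N.prio r.1 a r'.1 else N'.prio r.2 a r'.2
  let st : List A → P × P' := fun u => (f₁ u, f₂ u)
  have hst0 : st [] = (N.init, N'.init) := by simp only [st, hf0₁, hf0₂]
  have hst : ∀ u a, G (st u) a (st (u ++ [a])) := fun u a => ⟨hfs₁ u a, hfs₂ u a⟩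
  have hW : Wins (fun _ _ => True) G c Set.univ st fun u a => u ++ [a] := by
    refine ⟨fun _ _ _ _ => trivial, fun u _ a _ => hst u a, fun ρ w _ _ hn => ?_⟩
    obtain ⟨l, hl⟩ := reach_of_prefix_strategy (E := fun (u : List A) a u' => u' = u ++ [a])
      (F := id) (fun _ _ => rfl) (ρ 0)
    obtain ⟨ρ', w', k, h0, hE, hρ, hw⟩ := hl.prepend (ρ := ρ) (w := w) rfl hn
    have hpref : ∀ n, ρ' n = pref w' n := by
      intro n
      induction n with
      | zero => exact h0
      | succ n ih => rw [hE, ih, pref_succ]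
    have key : Good c (fun n => st (ρ' n)) w' := by
      simp only [hpref]
      by_cases hw' : w' ∈ L
      · exact ⟨true, hf₁ w' ((hN w').2 hw')⟩
      · exact ⟨false, hf₂ w' ((hN' w').2 hw')⟩
    obtain ⟨i, hi⟩ := key
    rw [← parityAcc_shift k] at hi
    refine ⟨i, ?_⟩
    simpa only [add_right_comm _ k 1, hρ, hw] using hi
  obtain ⟨X, f, hX, hmem⟩ := hW.exists_positional (fun u _ ρ w h0 hE hacc => by
    obtain ⟨l, hl⟩ := reach_of_prefix_strategy hst u
    obtain ⟨ρ', w', k, h0', hE', hρ, hw⟩ := hl.prepend h0 hE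
    rw [hst0] at h0'
    have hacc' : ∀ i, ParityAcc fun n => c i (ρ' n) (w' n) (ρ' (n + 1)) := fun i => by
      rw [← parityAcc_shift k]
      simpa only [add_right_comm _ k 1, hρ, hw] using hacc i
    exact (hN' w').1 ⟨fun n => (ρ' n).2, ⟨congrArg Prod.snd h0', fun n => (hE' n).2⟩, hacc' false⟩
      ((hN w').1 ⟨fun n => (ρ' n).1, ⟨congrArg Prod.fst h0', fun n => (hE' n).1⟩, hacc' true⟩))
    (Set.mem_univ [])
  let D : DPA A (P × P') := ⟨(N.init, N'.init), f, fun r a => N.prio r.1 a (f r a).1⟩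
  refine ⟨D, fun w => ?_⟩
  have hD : ∀ n, D.run w n ∈ X := by
    intro n
    induction n with
    | zero => rw [hst0] at hmem; exact hmem
    | succ n ih => exact hX.closed _ ih _ trivial
  have hE : ∀ n, G (D.run w n) (w n) (D.run w (n + 1)) := fun n => hX.edge _ (hD n) _ trivial
  constructor
  · exact fun h => (hN w).1 ⟨fun n => (D.run w n).1, ⟨rfl, fun n => (hE n).1⟩, h⟩
  · intro hw
    obtain ⟨i, hi⟩ := hX.good (D.run w) w (hD 0) (fun _ => trivial) fun _ => rfl
    cases i
    · exact absurd hw ((hN' w).1 ⟨fun n => (D.run w n).2, ⟨rfl, fun n => (hE n).2⟩, hi⟩)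
    · exact hi

/-! ### Universal automata for a language and its complement -/

/-- The residual of a good-for-games universal automaton after a first letter. -/
theorem UPA.residual {A S : Type} {E : UPA A S} {f : List A → S} (hf0 : f [] = E.init)
    (hfs : ∀ u a, f (u ++ [a]) ∈ E.Δ (f u) a)
    (hf : ∀ w, ¬ E.Accepts w →
      ¬ ParityAcc fun n => E.prio (f (pref w n)) (w n) (f (pref w (n + 1))))
    (a : A) {L : Set (ℕ → A)} (hL : ∀ w, E.Accepts (seqCons a w) ↔ w ∈ L) :
    (∀ (ρ : ℕ → S) (w : ℕ → A), ρ 0 = f [a] → (∀ n, ρ (n + 1) ∈ E.Δ (ρ n) (w n)) →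
      (¬ ParityAcc fun n => E.prio (ρ n) (w n) (ρ (n + 1))) → w ∉ L) ∧
    ∀ w, w ∉ L →
      ¬ ParityAcc fun n => E.prio (f (a :: pref w n)) (w n) (f (a :: pref w (n + 1))) := by
  constructor
  · intro ρ w h0 hn hacc hw
    have h := (hL w).2 hw (seqCons E.init ρ) ⟨rfl, fun n => by
      cases n with
      | zero => simpa [seqCons, h0, hf0] using hfs [] a
      | succ n => exact hn n⟩
    rw [← parityAcc_shift 1] at h
    exact hacc h
  · intro w hw hacc
    refine hf _ (fun h => hw ((hL w).1 h)) ?_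
    rw [← parityAcc_shift 1]
    simpa only [pref_cons, seqCons] using hacc

/-- If runs from `q₁` can reject exactly the words outside `L`, and runs from `q₂` exactly the words
in `L`, then `L` distinguishes only finitely many letters. -/
theorem exists_finite_alphabet {A S : Type} [Finite S] {Δ : S → A → Set S} {prio : S → A → S → ℕ}
    {q₁ q₂ : S} {L : Set (ℕ → A)}
    (h₁ : ∀ (ρ : ℕ → S) (w : ℕ → A), ρ 0 = q₁ → (∀ n, ρ (n + 1) ∈ Δ (ρ n) (w n)) →
      (¬ ParityAcc fun n => prio (ρ n) (w n) (ρ (n + 1))) → w ∉ L)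
    (h₂ : ∀ (ρ : ℕ → S) (w : ℕ → A), ρ 0 = q₂ → (∀ n, ρ (n + 1) ∈ Δ (ρ n) (w n)) →
      (¬ ParityAcc fun n => prio (ρ n) (w n) (ρ (n + 1))) → w ∈ L)
    (h₁' : ∀ w, w ∉ L → ∃ ρ : ℕ → S, ρ 0 = q₁ ∧ (∀ n, ρ (n + 1) ∈ Δ (ρ n) (w n)) ∧
      ¬ ParityAcc fun n => prio (ρ n) (w n) (ρ (n + 1)))
    (h₂' : ∀ w, w ∈ L → ∃ ρ : ℕ → S, ρ 0 = q₂ ∧ (∀ n, ρ (n + 1) ∈ Δ (ρ n) (w n)) ∧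
      ¬ ParityAcc fun n => prio (ρ n) (w n) (ρ (n + 1))) :
    ∃ rep : A → A, (Set.range rep).Finite ∧ ∀ w : ℕ → A, (fun n => rep (w n)) ∈ L ↔ w ∈ L := by
  let G : S × S → A → S × S → Prop := fun r a r' => r'.1 ∈ Δ r.1 a ∧ r'.2 ∈ Δ r.2 a
  let c₁ : (S × S) × A × (S × S) → ℕ := fun x => prio x.1.1 x.2.1 x.2.2.1
  let c₂ : (S × S) × A × (S × S) → ℕ := fun x => prio x.1.2 x.2.1 x.2.2.2
  have hbd : ∀ r, ∃ B, Reach G (q₁, q₂) r → (∀ l, Walk G r l r → ∀ x ∈ l, c₁ x ≤ B) ∨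
      ∀ l, Walk G r l r → ∀ x ∈ l, c₂ x ≤ B := by
    intro r
    by_contra! hcon
    obtain ⟨l₀, hl₀⟩ := (hcon 0).1
    choose y hy x hx hxB using fun B => (hcon B).2.1
    choose z hz x' hx' hxB' using fun B => (hcon B).2.2
    obtain ⟨ρ, w, h0, hE, -, hhit⟩ := Walk.concat (v := fun _ => r)
      (l := fun j => y j.unpair.1 ++ z j.unpair.1) (fun j => (hy _).append (hz _)) fun j h => by
        have := hx j.unpair.1
        simp_all
    obtain ⟨ρ', w', k, h0', hE', hρ, hw⟩ := hl₀.prepend h0 hE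
    have hrej : ∀ d : (S × S) × A × (S × S) → ℕ,
        (∀ B, ∃ x, (x ∈ y B ∨ x ∈ z B) ∧ B < d x) →
        ¬ ParityAcc fun n => d (ρ' n, w' n, ρ' (n + 1)) := by
      intro d hd hacc
      rw [← parityAcc_shift k] at hacc
      simp only [add_right_comm _ k 1, hρ, hw] at hacc
      obtain ⟨p, -, -, hp⟩ := hacc
      obtain ⟨x, hx, hpx⟩ := hd p
      refine hp _ hpx fun N => ?_
      obtain ⟨n, hn, rfl⟩ := hhit (Nat.pair p N) x
        (by simpa only [Nat.unpair_pair, List.mem_append] using hx)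
      exact ⟨n, (Nat.right_le_pair _ _).trans hn, rfl⟩
    exact h₁ (fun n => (ρ' n).1) w' (by simp [h0']) (fun n => (hE' n).1)
      (hrej c₁ fun B => ⟨x B, .inl (hx B), hxB B⟩)
      (h₂ (fun n => (ρ' n).2) w' (by simp [h0']) (fun n => (hE' n).2)
      (hrej c₂ fun B => ⟨x' B, .inr (hx' B), hxB' B⟩))
  choose Br hBr using hbd
  obtain ⟨B, hB⟩ := (Set.finite_range Br).bddAbove
  have hBle : ∀ r, Br r ≤ B := fun r => hB ⟨r, rfl⟩
  obtain ⟨rep, hfin, hrep⟩ := exists_representatives (A := A) fun (a : A) (s s' : S) =>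
    ((s' ∈ Δ s a : Prop), (⟨min (prio s a s') (B + 1), by omega⟩ : Fin (B + 2)))
  have hrep' := fun a s s' => Prod.ext_iff.1 (congrFun (congrFun (hrep a) s) s')
  have hΔ : ∀ a s s', s' ∈ Δ s (rep a) ↔ s' ∈ Δ s a := fun a s s' => iff_of_eq (hrep' a s s').1
  have hprio : ∀ a s s', min (prio s (rep a) s') (B + 1) = min (prio s a s') (B + 1) :=
    fun a s s' => congrArg Fin.val (hrep' a s s').2
  have key : ∀ w w' : ℕ → A, (∀ n s s', s' ∈ Δ s (w n) ↔ s' ∈ Δ s (w' n)) →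
      (∀ n s s', min (prio s (w n) s') (B + 1) = min (prio s (w' n) s') (B + 1)) →
      w ∉ L → w' ∉ L := by
    intro w w' hD hP hw hw'
    obtain ⟨ρ, h0, hρ, hrej⟩ := h₁' w hw
    obtain ⟨ρ', h0', hρ', hrej'⟩ := h₂' w' hw'
    let π : ℕ → S × S := fun n => (ρ n, ρ' n)
    have hπ : ∀ n, G (π n) (w n) (π (n + 1)) := fun n => ⟨hρ n, (hD _ _ _).2 (hρ' n)⟩
    obtain ⟨r, hr⟩ := infOften_pigeonhole π (p := fun _ => True) fun N => ⟨N, le_rfl, trivial⟩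
    obtain ⟨N, -, -, hN⟩ := hr 0
    have hreach : Reach G (q₁, q₂) r := by
      have := Reach.of_play hπ (Nat.zero_le N)
      rwa [hN, show π 0 = (q₁, q₂) by simp only [π, h0, h0']] at this
    have hloop : ∀ n, N ≤ n → ∃ l, Walk G r l r ∧ (π n, w n, π (n + 1)) ∈ l := by
      intro n hn
      obtain ⟨m, hm, -, hmr⟩ := hr (n + 1)
      obtain ⟨l, hl, hx⟩ := Walk.of_play hπ N (m - N)
      rw [show N + (m - N) = m by omega] at hl hx
      rw [hN, hmr] at hl
      exact ⟨l, hl, (hx _).2 ⟨n, hn, by omega, rfl⟩⟩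
    have heq : ∀ {x y : ℕ}, x ≤ B → min x (B + 1) = min y (B + 1) → x = y := by omega
    rcases hBr r hreach with h | h
    · refine h₁ ρ w' h0 (fun n => (hD _ _ _).1 (hρ n)) (fun hacc => hrej ?_) hw'
      refine parityAcc_of_eventually_eq hacc fun n (hn : N ≤ n) => ?_
      obtain ⟨l, hl, hx⟩ := hloop n hn
      exact (heq ((h l hl _ hx).trans (hBle r)) (hP n _ _)).symm
    · refine hw (h₂ ρ' w h0' (fun n => (hD _ _ _).2 (hρ' n)) fun hacc => hrej' ?_)
      refine parityAcc_of_eventually_eq hacc fun n (hn : N ≤ n) => ?_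
      obtain ⟨l, hl, hx⟩ := hloop n hn
      exact heq ((h l hl _ hx).trans (hBle r)) (hP n _ _)
  refine ⟨rep, hfin, fun w => ⟨fun h => ?_, fun h => ?_⟩⟩
  · by_contra hw
    exact key w _ (fun n s s' => (hΔ _ s s').symm) (fun n s s' => (hprio _ s s').symm) hw h
  · by_contra hw
    exact key _ w (fun n s s' => hΔ _ s s') (fun n s s' => hprio _ s s') hw h

/-- A good-for-games universal automaton for `a·L ∪ b·Lᶜ` yields a good-for-games nondeterministic
automaton for the complement of `L`, with the same states. -/
theorem UPA.exists_npa_compl {A S : Type} [Finite S] {a b : A} (hab : a ≠ b) {L : Set (ℕ → A)}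
    {E : UPA A S}
    (hE : ∀ w, E.Accepts w ↔ ((w 0 = a ∧ (fun i => w (i + 1)) ∈ L) ∨
      (w 0 = b ∧ (fun i => w (i + 1)) ∉ L))) (hgfg : E.GFG) :
    ∃ N : NPA A S, (∀ w, N.Accepts w ↔ w ∉ L) ∧ N.GFG := by
  obtain ⟨f, hf0, hfs, hf⟩ := hgfg
  obtain ⟨ha, ha'⟩ := UPA.residual hf0 hfs hf a (L := L) fun w => by simp [hE, hab, seqCons]
  obtain ⟨hb, hb'⟩ := UPA.residual hf0 hfs hf b (L := Lᶜ) fun w => by simp [hE, hab.symm, seqCons]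
  have hrun : ∀ (x : A) (w : ℕ → A) n,
      f (x :: pref w (n + 1)) ∈ E.Δ (f (x :: pref w n)) (w n) := fun x w n => by
    rw [pref_succ]
    exact hfs (x :: pref w n) (w n)
  obtain ⟨rep, hfin, hrep⟩ := exists_finite_alphabet (Δ := E.Δ) (prio := E.prio) (L := L) ha
    (fun ρ w h0 hn hr => not_not.1 (hb ρ w h0 hn hr))
    (fun w hw => ⟨fun n => f (a :: pref w n), rfl, hrun a w, ha' w hw⟩)
    (fun w hw => ⟨fun n => f (b :: pref w n), rfl, hrun b w, hb' w (not_not.2 hw)⟩)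
  obtain ⟨M, hM⟩ := exists_bound_on_letters (fun _ : Bool => E.prio) hfin
  let N : NPA A S := ⟨f [a], fun s x => E.Δ s (rep x), fun s x s' => E.prio s (rep x) s' + 1⟩
  have hsucc : ∀ (w : ℕ → A) (ρ : ℕ → S), (ParityAcc fun n => N.prio (ρ n) (w n) (ρ (n + 1))) ↔
      ¬ ParityAcc fun n => E.prio (ρ n) (rep (w n)) (ρ (n + 1)) := fun w ρ =>
    parityAcc_succ_of_bounded (B := M) fun n => hM true _ _ ⟨_, rfl⟩ _
  have hacc : ∀ w, w ∉ L → ParityAcc fun n =>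
      N.prio (f (a :: (pref w n).map rep)) (w n) (f (a :: (pref w (n + 1)).map rep)) := by
    intro w hw
    rw [hsucc]
    simpa only [pref_map] using ha' _ (fun h => hw ((hrep w).1 h))
  have hstep : ∀ u x, f (a :: (u ++ [x]).map rep) ∈ N.Δ (f (a :: u.map rep)) x := fun u x => by
    simpa using hfs (a :: u.map rep) (rep x)
  have hN : ∀ w, N.Accepts w ↔ w ∉ L := by
    intro w
    constructor
    · rintro ⟨ρ, ⟨h0, hn⟩, hρ⟩ hw
      exact ha ρ _ h0 hn ((hsucc w ρ).1 hρ) ((hrep w).2 hw)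
    · exact fun hw => ⟨fun n => f (a :: (pref w n).map rep), ⟨rfl, fun n => by
        dsimp only
        rw [pref_succ]
        exact hstep _ _⟩, hacc w hw⟩
  exact ⟨N, hN, fun u => f (a :: u.map rep), rfl, hstep, fun w hw => hacc w ((hN w).1 hw)⟩

/-- (1) from a GFG nondeterministic parity automaton for `L` and
one for its complement one obtains a deterministic parity automaton for `L`
with at most `|N|·|N'|` states; (2) consequently, if `L` is recognised by a GFG
NPA with `n` states while every deterministic parity automaton for `L` needs at
least `m` states, then every GFG universal parity automaton `E` for
`a·L ∪ b·L^c` satisfies `m ≤ n · |E|`. -/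
theorem gfg_product_determinisation_and_upw_lower_bound :
    (∀ (A P P' : Type) (iP : Fintype P) (iP' : Fintype P')
       (L : Set (ℕ → A)) (N : NPA A P) (N' : NPA A P'),
       (∀ w, N.Accepts w ↔ w ∈ L) → (∀ w, N'.Accepts w ↔ w ∉ L) →
       N.GFG → N'.GFG →
       ∃ (R : Type) (iR : Fintype R) (D : DPA A R),
         (∀ w, D.Accepts w ↔ w ∈ L) ∧
         @Fintype.card R iR ≤ @Fintype.card P iP * @Fintype.card P' iP') ∧
    (∀ (A : Type) (a b : A), a ≠ b →
      ∀ (L : Set (ℕ → A)) (m : ℕ) (P : Type) (iP : Fintype P) (N : NPA A P),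
        (∀ w, N.Accepts w ↔ w ∈ L) → N.GFG →
        (∀ (R : Type) (iR : Fintype R) (D : DPA A R),
          (∀ w, D.Accepts w ↔ w ∈ L) → m ≤ @Fintype.card R iR) →
        ∀ (S : Type) (iS : Fintype S) (E : UPA A S),
          (∀ w, E.Accepts w ↔
            ((w 0 = a ∧ (fun i => w (i + 1)) ∈ L) ∨
             (w 0 = b ∧ (fun i => w (i + 1)) ∉ L))) →
          E.GFG →
          m ≤ @Fintype.card P iP * @Fintype.card S iS) := by
  refine ⟨fun A P P' iP iP' L N N' hN hN' hgfg hgfg' => ?_,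
    fun A a b hab L m P iP N hN hgfg hm S iS E hE hEgfg => ?_⟩
  · obtain ⟨D, hD⟩ := exists_dpa_of_gfg hN hN' hgfg hgfg'
    exact ⟨P × P', inferInstance, D, hD, (Fintype.card_prod P P').le⟩
  · obtain ⟨N', hN', hgfg'⟩ := E.exists_npa_compl hab hE hEgfg
    obtain ⟨D, hD⟩ := exists_dpa_of_gfg hN hN' hgfg hgfg'
    exact (hm (P × S) inferInstance D hD).trans (Fintype.card_prod P S).le

end GFGPaper
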